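/- arXiv:2408.14021 — 2 statements merged into one kernel-verified Lean document; each statement's English description precedes it below -/
import Mathlib

section
/- Let F be a field, let m, n ≥ 1, let R = MvPolynomial (Fin m × Fin n) F be the polynomial ring in mn variables x_{ij}, and let X be the generic m×n matrix over R whose (i,j) entry is the variable x_{ij}. Then for every integer t with 1 ≤ t ≤ min(m,n), the determinantal ideal I_t(X) is a prime ideal of R; in particular, the zero locus of I_t(X) in the prime spectrum of R is an irreducible closed subset. -/
/-- The determinantal ideal `I_t(A)` of an `m × n` matrix `A` over a commutative ring `R`,
generated by all `t × t` minors of `A`. -/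
noncomputable def detIdeal {R : Type*} [CommRing R] {m n : ℕ}
    (A : Matrix (Fin m) (Fin n) R) (t : ℤ) : Ideal R :=
  Ideal.span { d : R | ∃ (f : Fin t.toNat → Fin m) (g : Fin t.toNat → Fin n),
    Function.Injective f ∧ Function.Injective g ∧ d = (A.submatrix f g).det }

/-- The maximal minor of `W` on the rows listed by `s`. -/
noncomputable def rowMinor {R : Type*} [CommRing R] {N m : ℕ} (W : Matrix (Fin N) (Fin m) R)
    (s : Fin m → Fin N) : R :=
  (W.submatrix s id).det

/-- The alternating map obtained by fixing the rows of a determinant outside `P`. -/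
noncomputable def partialDet {R : Type*} [CommRing R] {m : ℕ} (P : Fin m → Prop)
    [DecidablePred P] (z : {i // ¬ P i} → Fin m → R) :
    (Fin m → R) [⋀^{i // P i}]→ₗ[R] R :=
  { (Matrix.detRowAlternating (R := R) (n := Fin m)).toMultilinearMap.domDomRestrict P z with
    map_eq_zero_of_eq' := by
      intro v i j hij hne
      refine Matrix.det_zero_of_row_eq (i := i.1) (j := j.1) (fun h => hne (Subtype.ext h)) ?_
      simpa [i.2, j.2] using hij }

theorem partialDet_apply {R : Type*} [CommRing R] {m : ℕ} (P : Fin m → Prop)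
    [DecidablePred P] (z : {i // ¬ P i} → Fin m → R) (v : {i // P i} → Fin m → R) :
    partialDet P z v =
      Matrix.det (Matrix.of fun i => if h : P i then v ⟨i, h⟩ else z ⟨i, h⟩) :=
  rfl

theorem rowMinor_dite {R : Type*} [CommRing R] {N m : ℕ} (W : Matrix (Fin N) (Fin m) R)
    (P : Fin m → Prop) [DecidablePred P] (s : Fin m → Fin N) (v : {i // P i} → Fin N) :
    rowMinor W (fun i => if h : P i then v ⟨i, h⟩ else s i) =
      partialDet P (fun i => W (s i)) (fun i => W (v i)) := by
  rw [partialDet_apply, rowMinor]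
  congr 1
  ext i j
  by_cases h : P i <;> simp [h]

theorem AlternatingMap.eq_zero_of_card_lt {R M ι : Type*} [CommRing R] [AddCommGroup M]
    [Module R M] [Fintype ι] {m : ℕ} (h : m < Fintype.card ι)
    (g : (Fin m → R) [⋀^ι]→ₗ[R] M) : g = 0 := by
  refine Module.Basis.ext_alternating (Pi.basisFun R (Fin m)) fun v hv => ?_
  have := Fintype.card_le_of_injective v hv
  simp at this
  omega

/-- A permutation of a disjoint union on which `f` separates the two summands strictly decreases
the sum of `f` over the summand with large values, unless it preserves the summands. -/
theorem sum_comp_inl_lt {α β : Type*} [Fintype α] [Fintype β] (f : α ⊕ β → ℕ) (θ : ℕ)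
    (hα : ∀ a, θ < f (Sum.inl a)) (hβ : ∀ b, f (Sum.inr b) ≤ θ) (σ : Equiv.Perm (α ⊕ β))
    (hσ : σ ∉ (Equiv.Perm.sumCongrHom α β).range) :
    ∑ a, f (σ (Sum.inl a)) < ∑ a, f (Sum.inl a) := by
  classical
  set A : Finset (α ⊕ β) := Finset.univ.map Function.Embedding.inl with hA
  set A' : Finset (α ⊕ β) := A.map σ.toEmbedding with hA'
  have e1 : ∑ a, f (σ (Sum.inl a)) = ∑ x ∈ A', f x := by simp [hA, hA']
  have e2 : ∑ a, f (Sum.inl a) = ∑ x ∈ A, f x := by simp [hA]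
  have hcard : A'.card = A.card := by simp [hA']
  have hne : ¬ A' ⊆ A := by
    intro hsub
    refine hσ (Equiv.Perm.mem_sumCongrHom_range_of_perm_mapsTo_inl ?_)
    rintro _ ⟨a, rfl⟩
    have : σ (Sum.inl a) ∈ A := hsub (by simp [hA, hA'])
    simpa [hA] using this
  have hc : (A' \ A).card = (A \ A').card := by
    have h1 := Finset.card_sdiff_add_card_inter A' A
    have h2 := Finset.card_sdiff_add_card_inter A A'
    rw [Finset.inter_comm] at h2
    omega
  have hpos : (A \ A').Nonempty := by
    rw [← Finset.card_pos, ← hc, Finset.card_pos, Finset.sdiff_nonempty]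
    exact hne
  rw [e1, e2, ← Finset.sum_sdiff_lt_sum_sdiff]
  calc ∑ x ∈ A' \ A, f x ≤ (A' \ A).card • θ := by
        refine Finset.sum_le_card_nsmul _ _ _ fun x hx => ?_
        rcases x with a | b
        · simp [hA] at hx
        · exact hβ b
    _ = ∑ x ∈ A \ A', θ := by rw [hc]; simp
    _ < ∑ x ∈ A \ A', f x := by
        refine Finset.sum_lt_sum_of_nonempty hpos fun x hx => ?_
        rcases x with a | b
        · exact hα a
        · simp [hA] at hx

/-- One step of the straightening law. -/
theorem rowMinor_mul_rowMinor_mem {R : Type*} [CommRing R] {N m : ℕ}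
    (W : Matrix (Fin N) (Fin m) R) (s t : Fin m → Fin N) (hs : StrictMono s) (ht : StrictMono t)
    (i : Fin m) (hi : t i < s i) (V : AddSubgroup R)
    (hV : ∀ s' t' : Fin m → Fin N, ∑ l, (s' l : ℕ) < ∑ l, (s l : ℕ) →
      ∑ l, (s' l : ℕ) + ∑ l, (t' l : ℕ) = ∑ l, (s l : ℕ) + ∑ l, (t l : ℕ) →
      rowMinor W s' * rowMinor W t' ∈ V) :
    rowMinor W s * rowMinor W t ∈ V := by
  classical
  let a := partialDet (fun l : Fin m => i ≤ l) (fun l => W (s l))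
  let b := partialDet (fun l : Fin m => l ≤ i) (fun l => W (t l))
  let x : {l : Fin m // i ≤ l} ⊕ {l : Fin m // l ≤ i} → Fin N :=
    Sum.elim (fun l => s l) (fun l => t l)
  let term : Equiv.Perm ({l : Fin m // i ≤ l} ⊕ {l : Fin m // l ≤ i}) → R := fun σ =>
    a (fun l => W (x (σ (Sum.inl l)))) * b (fun l => W (x (σ (Sum.inr l))))
  have hcard : m < Fintype.card ({l : Fin m // i ≤ l} ⊕ {l : Fin m // l ≤ i}) := by
    have h1 : Fintype.card {l : Fin m // i ≤ l} = m - i := by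
      rw [Fintype.card_subtype, ← Fin.card_Ici i]
      congr 1; ext; simp
    have h2 : Fintype.card {l : Fin m // l ≤ i} = i + 1 := by
      rw [Fintype.card_subtype, ← Fin.card_Iic i]
      congr 1; ext; simp
    rw [Fintype.card_sum, h1, h2]
    omega
  have hzero : ∑ σ : Equiv.Perm.ModSumCongr {l : Fin m // i ≤ l} {l : Fin m // l ≤ i},
      LinearMap.mul' R R (AlternatingMap.domCoprod.summand a b σ (fun k => W (x k))) = 0 := by
    have := DFunLike.congr_fun
      (AlternatingMap.eq_zero_of_card_lt hcard (AlternatingMap.domCoprod a b)) (fun k => W (x k))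
    rw [AlternatingMap.domCoprod_apply] at this
    simpa using congrArg (LinearMap.mul' R R) this
  have hsummand : ∀ σ : Equiv.Perm ({l : Fin m // i ≤ l} ⊕ {l : Fin m // l ≤ i}),
      LinearMap.mul' R R (AlternatingMap.domCoprod.summand a b (Quotient.mk'' σ)
        (fun k => W (x k))) = Equiv.Perm.sign σ • term σ := by
    intro σ
    rw [AlternatingMap.domCoprod.summand_mk'']
    simp [term, MultilinearMap.domCoprod_apply]
  have hterm : ∀ σ, term σ = rowMinor W (fun l => if h : i ≤ l then x (σ (Sum.inl ⟨l, h⟩)) else s l)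
      * rowMinor W (fun l => if h : l ≤ i then x (σ (Sum.inr ⟨l, h⟩)) else t l) := by
    intro σ
    rw [rowMinor_dite W (fun l => i ≤ l) s (fun l => x (σ (Sum.inl l))),
      rowMinor_dite W (fun l => l ≤ i) t (fun l => x (σ (Sum.inr l)))]
  have hone : term 1 = rowMinor W s * rowMinor W t := by
    rw [hterm]
    simp [x]
  have hsplit : ∀ (P : Fin m → Prop) [DecidablePred P] (v : {l // P l} → Fin N) (u : Fin m → Fin N),
      ∑ l, ((if h : P l then v ⟨l, h⟩ else u l : Fin N) : ℕ) =
        ∑ l, (v l : ℕ) + ∑ l : {l // ¬ P l}, (u l : ℕ) := by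
    intro P _ v u
    rw [← Fintype.sum_subtype_add_sum_subtype P]
    congr 1
    · exact Finset.sum_congr rfl fun l _ => by simp [l.2]
    · exact Finset.sum_congr rfl fun l _ => by simp [l.2]
  rw [← hone]
  have hmem : ∀ σ, σ ∉ (Equiv.Perm.sumCongrHom {l : Fin m // i ≤ l} {l : Fin m // l ≤ i}).range →
      term σ ∈ V := by
    intro σ hσ
    have hlt := sum_comp_inl_lt (fun k => (x k : ℕ)) (t i : ℕ)
      (fun l => lt_of_lt_of_le hi (hs.monotone l.2)) (fun l => ht.monotone l.2) σ hσ
    have htot : ∑ l, (x (σ (Sum.inl l)) : ℕ) + ∑ l, (x (σ (Sum.inr l)) : ℕ) =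
        ∑ l, (x (Sum.inl l) : ℕ) + ∑ l, (x (Sum.inr l) : ℕ) := by
      rw [← Fintype.sum_sum_type (fun k => (x (σ k) : ℕ)),
        ← Fintype.sum_sum_type (fun k => (x k : ℕ))]
      exact Equiv.sum_comp σ (fun k => (x k : ℕ))
    have hs0 := hsplit (fun l => i ≤ l) (fun l => s l) s
    have ht0 := hsplit (fun l => l ≤ i) (fun l => t l) t
    simp only [dite_eq_ite, ite_self] at hs0 ht0
    simp only [x, Sum.elim_inl, Sum.elim_inr] at hlt htot
    rw [hterm]
    refine hV _ _ ?_ ?_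
    · rw [hsplit (fun l => i ≤ l) (fun l => x (σ (Sum.inl l))), hs0]
      simp only [x]
      omega
    · rw [hsplit (fun l => i ≤ l) (fun l => x (σ (Sum.inl l))),
        hsplit (fun l => l ≤ i) (fun l => x (σ (Sum.inr l))), hs0, ht0]
      simp only [x]
      omega
  obtain ⟨G, hG⟩ : ∃ G : Equiv.Perm.ModSumCongr {l : Fin m // i ≤ l} {l : Fin m // l ≤ i} → R,
      G = fun σ => LinearMap.mul' R R
        (AlternatingMap.domCoprod.summand a b σ (fun k => W (x k))) := ⟨_, rfl⟩
  have hGmk : ∀ σ, G (Quotient.mk'' σ) = Equiv.Perm.sign σ • term σ := by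
    intro σ
    rw [hG, ← hsummand]
  have hGone : G (Quotient.mk'' 1) = term 1 := by
    rw [hGmk, Equiv.Perm.sign_one, one_smul]
  have hGzero : ∑ σ, G σ = 0 := by
    rw [hG, ← hzero]
  rw [← Finset.add_sum_erase _ G (Finset.mem_univ (Quotient.mk'' 1))] at hGzero
  rw [← hGone, eq_neg_of_add_eq_zero_left hGzero]
  refine V.neg_mem (V.sum_mem fun q hq => ?_)
  induction q using Quotient.inductionOn' with | _ σ
  rw [hGmk]
  have : term σ ∈ V := by
    refine hmem σ fun hσ => (Finset.ne_of_mem_erase hq) ?_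
    refine (QuotientGroup.eq (s := (Equiv.Perm.sumCongrHom _ _).range)).2 ?_
    simpa using hσ
  rcases Int.units_eq_one_or (Equiv.Perm.sign σ) with h | h <;> rw [h]
  · simpa using this
  · simpa using this

theorem rowMinor_comp_perm {R : Type*} [CommRing R] {N m : ℕ} (W : Matrix (Fin N) (Fin m) R)
    (s : Fin m → Fin N) (σ : Equiv.Perm (Fin m)) :
    rowMinor W (s ∘ σ) = (Equiv.Perm.sign σ : ℤ) * rowMinor W s :=
  Matrix.det_permute σ (W.submatrix s id)

theorem rowMinor_eq_zero_of_not_injective {R : Type*} [CommRing R] {N m : ℕ}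
    (W : Matrix (Fin N) (Fin m) R) (s : Fin m → Fin N) (hs : ¬ Function.Injective s) :
    rowMinor W s = 0 := by
  simp only [Function.Injective, not_forall] at hs
  obtain ⟨i, j, hij, hne⟩ := hs
  exact Matrix.det_zero_of_row_eq hne (by ext; simp [hij])

theorem rowMinor_eq_or_eq_neg_sort {R : Type*} [CommRing R] {N m : ℕ}
    (W : Matrix (Fin N) (Fin m) R) (s : Fin m → Fin N) :
    rowMinor W s = rowMinor W (s ∘ Tuple.sort s) ∨
      rowMinor W s = -rowMinor W (s ∘ Tuple.sort s) := by
  rw [rowMinor_comp_perm]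
  rcases Int.units_eq_one_or (Equiv.Perm.sign (Tuple.sort s)) with h | h <;> simp [h]

/-- A family of pairwise comparable tuples becomes a chain after reindexing. -/
theorem exists_perm_monotone {d m N : ℕ} (T : Fin d → Fin m → Fin N)
    (hT : ∀ j k, ∑ l, (T j l : ℕ) ≤ ∑ l, (T k l : ℕ) → T j ≤ T k) :
    ∃ σ : Equiv.Perm (Fin d), Monotone (T ∘ σ) :=
  ⟨Tuple.sort fun j => ∑ l, (T j l : ℕ), fun _ _ h =>
    hT _ _ (Tuple.monotone_sort (fun j => ∑ l, (T j l : ℕ)) h)⟩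

/-- The straightening law: products of maximal minors are integral combinations of products
along chains of strictly increasing tuples. -/
theorem prod_rowMinor_mem {R : Type*} [CommRing R] {N m d : ℕ} (W : Matrix (Fin N) (Fin m) R)
    (V : AddSubgroup R)
    (hV : ∀ T : Fin d → Fin m → Fin N, Monotone T → (∀ j, StrictMono (T j)) →
      ∏ j, rowMinor W (T j) ∈ V) (T : Fin d → Fin m → Fin N) :
    ∏ j, rowMinor W (T j) ∈ V := by
  have hbound : ∀ T : Fin d → Fin m → Fin N,
      ∑ j, (∑ l, (T j l : ℕ)) ^ 2 ≤ d * (m * N) ^ 2 := by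
    intro T
    calc ∑ j, (∑ l, (T j l : ℕ)) ^ 2 ≤ ∑ _j : Fin d, (m * N) ^ 2 := by
          gcongr with j
          calc ∑ l, (T j l : ℕ) ≤ ∑ _l : Fin m, N := by
                gcongr with l
                exact (T j l).2.le
            _ = m * N := by simp
      _ = d * (m * N) ^ 2 := by simp
  induction hn : d * (m * N) ^ 2 - ∑ j, (∑ l, (T j l : ℕ)) ^ 2 using Nat.strong_induction_on
    generalizing T with | _ n ih =>
  by_cases hinj : ∀ j, Function.Injective (T j)
  swap
  · obtain ⟨j, hj⟩ := not_forall.1 hinj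
    rw [Finset.prod_eq_zero (Finset.mem_univ j) (rowMinor_eq_zero_of_not_injective W _ hj)]
    exact V.zero_mem
  -- Reduce to the case of strictly increasing tuples.
  set S : Fin d → Fin m → Fin N := fun j => T j ∘ Tuple.sort (T j) with hS
  have hsum : ∀ j, ∑ l, (S j l : ℕ) = ∑ l, (T j l : ℕ) := fun j =>
    Equiv.sum_comp (Tuple.sort (T j)) fun l => (T j l : ℕ)
  have hstrict : ∀ j, StrictMono (S j) := fun j =>
    (Tuple.monotone_sort (T j)).strictMono_of_injective ((hinj j).comp (Equiv.injective _))
  have hprod : ∏ j, rowMinor W (T j) = ∏ j, rowMinor W (S j) ∨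
      ∏ j, rowMinor W (T j) = -∏ j, rowMinor W (S j) := by
    have : ∀ A : Finset (Fin d), ∏ j ∈ A, rowMinor W (T j) = ∏ j ∈ A, rowMinor W (S j) ∨
        ∏ j ∈ A, rowMinor W (T j) = -∏ j ∈ A, rowMinor W (S j) := by
      intro A
      induction A using Finset.induction_on with
      | empty => simp
      | insert j A hj ih' =>
        rw [Finset.prod_insert hj, Finset.prod_insert hj]
        rcases rowMinor_eq_or_eq_neg_sort W (T j) with h | h <;> rcases ih' with h' | h' <;>
          rw [h, h'] <;> simp [hS]
    exact this Finset.univ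
  suffices h : ∏ j, rowMinor W (S j) ∈ V by
    rcases hprod with h' | h' <;> rw [h']
    · exact h
    · exact V.neg_mem h
  by_cases hcomp : ∀ j k, ∑ l, (S j l : ℕ) ≤ ∑ l, (S k l : ℕ) → S j ≤ S k
  · obtain ⟨σ, hσ⟩ := exists_perm_monotone S hcomp
    rw [← Equiv.prod_comp σ]
    exact hV (S ∘ σ) hσ fun j => hstrict _
  push Not at hcomp
  obtain ⟨j, k, hjk, hnot⟩ := hcomp
  obtain ⟨i, hi⟩ : ∃ i, S k i < S j i := by
    simpa [Pi.le_def] using hnot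
  have hne : j ≠ k := by
    rintro rfl
    exact hnot le_rfl
  have hk : k ∈ Finset.univ.erase j := by simp [hne.symm]
  have hpair : ∀ f : Fin d → R, ∏ a, f a =
      f j * f k * ∏ a ∈ (Finset.univ.erase j).erase k, f a := by
    intro f
    rw [mul_assoc, Finset.mul_prod_erase _ f hk, Finset.mul_prod_erase _ f (Finset.mem_univ j)]
  have hpair' : ∀ f : Fin d → ℕ, ∑ a, f a =
      f j + f k + ∑ a ∈ (Finset.univ.erase j).erase k, f a := by
    intro f
    rw [add_assoc, Finset.add_sum_erase _ f hk, Finset.add_sum_erase _ f (Finset.mem_univ j)]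
  rw [hpair]
  refine rowMinor_mul_rowMinor_mem W (S j) (S k) (hstrict j) (hstrict k) i hi
    (V.comap (AddMonoidHom.mulRight (∏ a ∈ (Finset.univ.erase j).erase k, rowMinor W (S a)))) ?_
  intro s' t' hlt htot
  rw [AddSubgroup.mem_comap, AddMonoidHom.mulRight_apply]
  set T' : Fin d → Fin m → Fin N := Function.update (Function.update S j s') k t' with hT'
  have hT'j : T' j = s' := by simp [hT', hne]
  have hT'k : T' k = t' := by simp [hT']
  have hT'a : ∀ a ∈ (Finset.univ.erase j).erase k, T' a = S a := by
    intro a ha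
    simp only [Finset.mem_erase] at ha
    simp [hT', ha.1, ha.2.1]
  have hval : ∏ a, rowMinor W (T' a) = rowMinor W s' * rowMinor W t' *
      ∏ a ∈ (Finset.univ.erase j).erase k, rowMinor W (S a) := by
    rw [hpair, hT'j, hT'k]
    congr 1
    exact Finset.prod_congr rfl fun a ha => by rw [hT'a a ha]
  rw [← hval]
  have hinc : ∑ a, (∑ l, (T a l : ℕ)) ^ 2 < ∑ a, (∑ l, (T' a l : ℕ)) ^ 2 := by
    simp_rw [← hsum]
    rw [hpair', hpair' fun a => (∑ l, (T' a l : ℕ)) ^ 2, hT'j, hT'k]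
    have hrest : ∑ a ∈ (Finset.univ.erase j).erase k, (∑ l, (T' a l : ℕ)) ^ 2 =
        ∑ a ∈ (Finset.univ.erase j).erase k, (∑ l, (S a l : ℕ)) ^ 2 :=
      Finset.sum_congr rfl fun a ha => by rw [hT'a a ha]
    rw [hrest]
    gcongr ?_ + _
    generalize ∑ l, (s' l : ℕ) = p at *
    generalize ∑ l, (t' l : ℕ) = q at *
    generalize ∑ l, (S j l : ℕ) = u at *
    generalize ∑ l, (S k l : ℕ) = v at *
    obtain ⟨e, rfl⟩ := Nat.exists_eq_add_of_lt hlt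
    obtain rfl : q = v + e + 1 := by omega
    nlinarith
  exact ih _ (by have := hbound T'; omega) T' rfl

/-- `μ` is the unique exponent of maximal weight in `p`, and its coefficient is `1`. -/
def HasInitialMonomial {σ R : Type*} [CommRing R] (w : σ → ℕ) (p : MvPolynomial σ R)
    (μ : σ →₀ ℕ) : Prop :=
  p.coeff μ = 1 ∧ ∀ ν ∈ p.support, ν ≠ μ → Finsupp.weight w ν < Finsupp.weight w μ

namespace HasInitialMonomial

variable {σ R : Type*} [CommRing R] {w : σ → ℕ}

theorem weight_le {p : MvPolynomial σ R} {μ ν : σ →₀ ℕ} (h : HasInitialMonomial w p μ)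
    (hν : ν ∈ p.support) : Finsupp.weight w ν ≤ Finsupp.weight w μ := by
  by_cases hne : ν = μ
  · rw [hne]
  · exact (h.2 ν hν hne).le

theorem ne_zero [Nontrivial R] {p : MvPolynomial σ R} {μ : σ →₀ ℕ}
    (h : HasInitialMonomial w p μ) : p ≠ 0 := by
  rintro rfl
  simpa using h.1

theorem one : HasInitialMonomial w (1 : MvPolynomial σ R) 0 := by
  classical
  refine ⟨by simp, fun ν hν hne => absurd hν ?_⟩
  simp [MvPolynomial.mem_support_iff, MvPolynomial.coeff_one, hne.symm]

theorem mul {p q : MvPolynomial σ R} {μ ν : σ →₀ ℕ} (hp : HasInitialMonomial w p μ)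
    (hq : HasInitialMonomial w q ν) : HasInitialMonomial w (p * q) (μ + ν) := by
  classical
  constructor
  · rw [MvPolynomial.coeff_mul, Finset.sum_eq_single (μ, ν)]
    · simp [hp.1, hq.1]
    · rintro ⟨a, b⟩ hab hne
      rw [Finset.HasAntidiagonal.mem_antidiagonal] at hab
      dsimp only at hab ⊢
      by_contra h0
      have ha : a ∈ p.support := MvPolynomial.mem_support_iff.2 (left_ne_zero_of_mul h0)
      have hb : b ∈ q.support := MvPolynomial.mem_support_iff.2 (right_ne_zero_of_mul h0)
      have haμ : a ≠ μ := by
        rintro rfl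
        exact hne (by rw [add_left_cancel hab])
      have h1 := hp.2 a ha haμ
      have h2 := hq.weight_le hb
      have h3 := congrArg (Finsupp.weight w) hab
      rw [map_add, map_add] at h3
      omega
    · intro h
      simp at h
  · intro κ hκ hne
    obtain ⟨a, ha, b, hb, rfl⟩ := Finset.mem_add.1 (MvPolynomial.support_mul p q hκ)
    rw [map_add, map_add]
    by_cases haμ : a = μ
    · subst haμ
      have := hq.2 b hb fun h => hne (by rw [h])
      omega
    · have := hp.2 a ha haμ
      have := hq.weight_le hb
      omega

theorem prod {ι : Type*} (s : Finset ι) {p : ι → MvPolynomial σ R} {μ : ι → σ →₀ ℕ}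
    (h : ∀ i ∈ s, HasInitialMonomial w (p i) (μ i)) :
    HasInitialMonomial w (∏ i ∈ s, p i) (∑ i ∈ s, μ i) := by
  classical
  induction s using Finset.induction_on with
  | empty => simpa using one
  | insert a s ha ih =>
    rw [Finset.prod_insert ha, Finset.sum_insert ha]
    exact (h a (Finset.mem_insert_self a s)).mul
      (ih fun i hi => h i (Finset.mem_insert_of_mem hi))

theorem linearIndependent {ι : Type*} {p : ι → MvPolynomial σ R} {μ : ι → σ →₀ ℕ}
    (h : ∀ i, HasInitialMonomial w (p i) (μ i)) (hμ : Function.Injective μ) :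
    LinearIndependent R p := by
  classical
  rw [linearIndependent_iff']
  intro s g hg
  by_contra hne
  push Not at hne
  obtain ⟨i₀, hi₀, hmax⟩ := Finset.exists_max_image (s.filter fun i => g i ≠ 0)
    (fun i => Finsupp.weight w (μ i)) (by
      obtain ⟨i, hi, hgi⟩ := hne
      exact ⟨i, by simp [hi, hgi]⟩)
  rw [Finset.mem_filter] at hi₀
  refine hi₀.2 ?_
  have hc := congrArg (MvPolynomial.coeff (μ i₀)) hg
  rw [MvPolynomial.coeff_sum, Finset.sum_eq_single i₀] at hc
  · simpa [(h i₀).1] using hc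
  · intro i hi hii
    rw [MvPolynomial.coeff_smul, smul_eq_mul]
    by_contra h0
    have hlt := (h i).2 (μ i₀) (MvPolynomial.mem_support_iff.2 (right_ne_zero_of_mul h0))
      fun he => hii (hμ he.symm)
    have := hmax i (by simp [hi, left_ne_zero_of_mul h0])
    omega
  · exact fun h' => absurd hi₀.1 h'

end HasInitialMonomial

theorem Equiv.Perm.sum_comp_mul_lt {m : ℕ} (s : Fin m → ℕ) (hs : StrictMono s)
    (σ : Equiv.Perm (Fin m)) (hσ : σ ≠ 1) :
    ∑ i, s (σ i) * (i : ℕ) < ∑ i, s i * (i : ℕ) := by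
  have hmono : Monovary s (fun i : Fin m => (i : ℕ)) := fun i j hij => hs.monotone (le_of_lt hij)
  refine hmono.sum_comp_perm_mul_lt_sum_mul_iff.2 fun h => hσ ?_
  have hσm : StrictMono σ := by
    intro i j hij
    have h1 : s (σ i) ≤ s (σ j) := h (show (i : ℕ) < j from hij)
    exact lt_of_le_of_ne (hs.le_iff_le.1 h1) (σ.injective.ne hij.ne)
  exact Equiv.ext fun i => congrFun
    ((StrictMono.range_inj hσm strictMono_id).1 (by simp [σ.surjective.range_eq])) i

/-- The generic matrix with the entries outside of `P` replaced by zero. -/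
noncomputable def sparseGenericMatrix (R : Type*) [CommRing R] {N m : ℕ}
    (P : Fin N → Fin m → Prop) [∀ c i, Decidable (P c i)] :
    Matrix (Fin N) (Fin m) (MvPolynomial (Fin N × Fin m) R) :=
  Matrix.of fun c i => if P c i then MvPolynomial.X (c, i) else 0

theorem rowMinor_sparseGenericMatrix {R : Type*} [CommRing R] {N m : ℕ}
    (P : Fin N → Fin m → Prop) [∀ c i, Decidable (P c i)] (s : Fin m → Fin N)
    (hs : StrictMono s) (hP : ∀ i, P (s i) i) :
    HasInitialMonomial (fun x : Fin N × Fin m => (x.1 : ℕ) * x.2)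
      (rowMinor (sparseGenericMatrix R P) s) (∑ i, Finsupp.single (s i, i) 1) := by
  classical
  set w : Fin N × Fin m → ℕ := fun x => (x.1 : ℕ) * x.2 with hw
  let μ : Equiv.Perm (Fin m) → (Fin N × Fin m →₀ ℕ) :=
    fun σ => ∑ i, Finsupp.single (s (σ i), i) 1
  have hweight : ∀ σ, Finsupp.weight w (μ σ) = ∑ i, (s (σ i) : ℕ) * i := by
    intro σ
    simp [μ, Finsupp.weight_single, hw]
  have hlt : ∀ σ, σ ≠ 1 → Finsupp.weight w (μ σ) < Finsupp.weight w (μ 1) := by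
    intro σ hσ
    rw [hweight, hweight]
    exact Equiv.Perm.sum_comp_mul_lt (fun i => (s i : ℕ)) hs σ hσ
  have hmonomial : ∀ σ : Equiv.Perm (Fin m),
      ∏ i, (MvPolynomial.X (s (σ i), i) : MvPolynomial (Fin N × Fin m) R) =
        MvPolynomial.monomial (μ σ) 1 := by
    intro σ
    simp only [μ, MvPolynomial.monomial_sum_one]
    rfl
  have hterm : ∀ σ : Equiv.Perm (Fin m), ∀ ν,
      MvPolynomial.coeff ν (∏ i, sparseGenericMatrix R P (s (σ i)) i) ≠ 0 → ν = μ σ := by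
    intro σ ν hν
    by_cases hall : ∀ i, P (s (σ i)) i
    · have : ∏ i, sparseGenericMatrix R P (s (σ i)) i = MvPolynomial.monomial (μ σ) 1 := by
        rw [← hmonomial]
        exact Finset.prod_congr rfl fun i _ => by simp [sparseGenericMatrix, hall i]
      rw [this, MvPolynomial.coeff_monomial] at hν
      by_contra hne
      exact hν (if_neg (Ne.symm hne))
    · obtain ⟨i, hi⟩ := not_forall.1 hall
      refine absurd ?_ hν
      rw [Finset.prod_eq_zero (Finset.mem_univ i) (by simp [sparseGenericMatrix, hi])]
      simp
  have hdet : ∀ ν, MvPolynomial.coeff ν (rowMinor (sparseGenericMatrix R P) s) =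
      ∑ σ : Equiv.Perm (Fin m), (Equiv.Perm.sign σ : ℤ) •
        MvPolynomial.coeff ν (∏ i, sparseGenericMatrix R P (s (σ i)) i) := by
    intro ν
    rw [rowMinor, Matrix.det_apply, MvPolynomial.coeff_sum]
    refine Finset.sum_congr rfl fun σ _ => ?_
    rcases Int.units_eq_one_or (Equiv.Perm.sign σ) with h | h <;> simp [h]
  have hμ1 : (∑ i, Finsupp.single (s i, i) 1 : Fin N × Fin m →₀ ℕ) = μ 1 := rfl
  rw [hμ1]
  constructor
  · rw [hdet, Finset.sum_eq_single 1]
    · have : ∏ i, sparseGenericMatrix R P (s ((1 : Equiv.Perm (Fin m)) i)) i =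
          MvPolynomial.monomial (μ 1) 1 := by
        rw [← hmonomial]
        exact Finset.prod_congr rfl fun i _ => by simp [sparseGenericMatrix, hP i]
      rw [this]
      simp
    · intro σ _ hσ
      by_contra h0
      have := hterm σ (μ 1) fun h => h0 (by rw [h, smul_zero])
      exact (hlt σ hσ).ne (by rw [this])
    · simp
  · intro ν hν hne
    rw [MvPolynomial.mem_support_iff, hdet] at hν
    obtain ⟨σ, -, hσ⟩ := Finset.exists_ne_zero_of_sum_ne_zero hν
    obtain rfl := hterm σ ν fun h => hσ (by rw [h, smul_zero])
    exact hlt σ fun h => hne (by rw [h])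

theorem Monotone.eq_of_card_fiber_eq {d : ℕ} {α : Type*} [LinearOrder α] {f g : Fin d → α}
    (hf : Monotone f) (hg : Monotone g)
    (h : ∀ a, (Finset.univ.filter fun j => f j = a).card =
      (Finset.univ.filter fun j => g j = a).card) : f = g := by
  have hperm : (List.ofFn f).Perm (List.ofFn g) := by
    rw [List.perm_iff_count]
    intro a
    have hcount : ∀ k : Fin d → α, List.count a (List.ofFn k) =
        (Finset.univ.filter fun j => k j = a).card := by
      intro k
      rw [List.ofFn_eq_map, ← Multiset.coe_count, ← Multiset.map_coe, Multiset.count_map]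
      simp [Finset.card_def, Finset.filter_val, eq_comm, Finset.univ, Fintype.elems]
    rw [hcount, hcount, h]
  exact List.ofFn_injective <| hperm.eq_of_pairwise' hf.sortedLE_ofFn.pairwise
    hg.sortedLE_ofFn.pairwise

theorem chain_exponent_injective {d m N : ℕ} {T T' : Fin d → Fin m → Fin N}
    (hT : Monotone T) (hT' : Monotone T')
    (h : (∑ j, ∑ i, Finsupp.single (T j i, i) 1 : Fin N × Fin m →₀ ℕ) =
      ∑ j, ∑ i, Finsupp.single (T' j i, i) 1) : T = T' := by
  classical
  have hcount : ∀ (S : Fin d → Fin m → Fin N) (c : Fin N) (i : Fin m),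
      (∑ j, ∑ i, Finsupp.single (S j i, i) 1 : Fin N × Fin m →₀ ℕ) (c, i) =
        (Finset.univ.filter fun j => S j i = c).card := by
    intro S c i
    rw [Finset.card_filter, Finsupp.finsetSum_apply]
    refine Finset.sum_congr rfl fun j _ => ?_
    rw [Finsupp.finsetSum_apply, Finset.sum_eq_single i]
    · simp [Finsupp.single_apply]
    · intro b _ hb
      simp [hb]
    · simp
  have hcol : ∀ i, (fun j => T j i) = fun j => T' j i := by
    intro i
    refine Monotone.eq_of_card_fiber_eq (fun _ _ hjk => hT hjk i) (fun _ _ hjk => hT' hjk i) ?_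
    intro c
    rw [← hcount, ← hcount, h]
  ext j i
  rw [congrFun (hcol i) j]

/-- A determinant lies in any ideal containing the `t × t` minors on its first `t` rows. -/
theorem det_mem_of_minors_mem {R : Type*} [CommRing R] {m t : ℕ} (A : Matrix (Fin m) (Fin m) R)
    (J : Ideal R) (ht : t ≤ m)
    (hJ : ∀ f : Fin t → Fin m, (A.submatrix (Fin.castLE ht) f).det ∈ J) : A.det ∈ J := by
  have key : ∀ k (hk : k ≤ m), t ≤ k →
      ∀ f : Fin k → Fin m, (A.submatrix (Fin.castLE hk) f).det ∈ J := by
    intro k hk htk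
    induction k, htk using Nat.le_induction with
    | base => exact hJ
    | succ k htk ih =>
      intro f
      rw [Matrix.det_succ_row _ (Fin.last k)]
      refine J.sum_mem fun j _ => J.mul_mem_left _ ?_
      have := ih (by omega) (f ∘ j.succAbove)
      rw [Matrix.submatrix_submatrix]
      convert this using 3
      ext i
      simp
  simpa using key m le_rfl ht id

theorem det_submatrix_mul_eq_zero {K : Type*} [Field K] {m r : ℕ} {ι κ κ' : Type*} [Fintype ι]
    [DecidableEq ι] (h : r < Fintype.card ι) (A : Matrix κ (Fin m) K) (B : Matrix (Fin m) κ' K)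
    (hA : ∀ c (i : Fin m), r ≤ i → A c i = 0) (f : ι → κ) (g : ι → κ') :
    ((A * B).submatrix f g).det = 0 := by
  have hfac : (A * B).submatrix f g =
      A.submatrix f (fun i : {i : Fin m // (i : ℕ) < r} => i.1) *
        B.submatrix (fun i : {i : Fin m // (i : ℕ) < r} => i.1) g := by
    ext a b
    rw [Matrix.submatrix_apply, Matrix.mul_apply, Matrix.mul_apply,
      ← Fintype.sum_subtype_add_sum_subtype (fun i : Fin m => (i : ℕ) < r)]
    rw [Finset.sum_eq_zero (s := Finset.univ (α := {i : Fin m // ¬ (i : ℕ) < r}))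
      fun i _ => by rw [hA _ _ (not_lt.1 i.2), zero_mul], add_zero]
    rfl
  have hcard : Fintype.card {i : Fin m // (i : ℕ) < r} ≤ r := by
    simpa using Fintype.card_le_of_injective
      (fun i : {i : Fin m // (i : ℕ) < r} => (⟨i.1, i.2⟩ : Fin r))
      fun i j hij => Subtype.ext (Fin.ext (by simpa using hij))
  by_contra hdet
  have hunit : IsUnit ((A * B).submatrix f g) :=
    (Matrix.isUnit_iff_isUnit_det _).2 (isUnit_iff_ne_zero.2 hdet)
  have hrank := Matrix.rank_of_isUnit _ hunit
  rw [hfac] at hrank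
  have h1 := Matrix.rank_mul_le_left (A.submatrix f (fun i : {i : Fin m // (i : ℕ) < r} => i.1))
    (B.submatrix (fun i : {i : Fin m // (i : ℕ) < r} => i.1) g)
  have h2 := Matrix.rank_le_card_width
    (A.submatrix f (fun i : {i : Fin m // (i : ℕ) < r} => i.1))
  omega

section Determinantal

variable (F : Type*) [Field F] (m n : ℕ)

/-- The transpose of the generic `m × n` matrix stacked on top of the identity matrix. -/
noncomputable def stackedGenericMatrix :
    Matrix (Fin (n + m)) (Fin m) (MvPolynomial (Fin m × Fin n) F) :=
  Matrix.of fun c i => Fin.addCases (fun j => MvPolynomial.X (i, j))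
    (fun k => if k = i then 1 else 0) c

/-- A generic `(n + m) × m` matrix whose top `n × m` block is supported on the first `r` columns. -/
noncomputable def lowRankGenericMatrix (r : ℕ) :
    Matrix (Fin (n + m)) (Fin m) (MvPolynomial (Fin (n + m) × Fin m) F) :=
  sparseGenericMatrix F fun c i => n ≤ c ∨ (i : ℕ) < r

/-- The function field of the space of low rank generic matrices. -/
abbrev LowRankField : Type _ := FractionRing (MvPolynomial (Fin (n + m) × Fin m) F)

/-- The low rank generic matrix over the function field. -/
noncomputable def lowRankFieldMatrix (r : ℕ) :
    Matrix (Fin (n + m)) (Fin m) (LowRankField F m n) :=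
  (lowRankGenericMatrix F m n r).map (algebraMap _ _)

/-- The bottom square block of the low rank generic matrix. -/
noncomputable def lowRankBlock (r : ℕ) : Matrix (Fin m) (Fin m) (LowRankField F m n) :=
  (lowRankFieldMatrix F m n r).submatrix (Fin.natAdd n) id

/-- The evaluation of the generic `m × n` matrix at a generic matrix of rank at most `r`. -/
noncomputable def lowRankEval (r : ℕ) : MvPolynomial (Fin m × Fin n) F →ₐ[F] LowRankField F m n :=
  MvPolynomial.aeval fun x =>
    (lowRankFieldMatrix F m n r * (lowRankBlock F m n r)⁻¹) (Fin.castAdd m x.2) x.1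

variable {F m n}

theorem rowMinor_map {R S : Type*} [CommRing R] [CommRing S] {N k : ℕ} (φ : R →+* S)
    (W : Matrix (Fin N) (Fin k) R) (s : Fin k → Fin N) :
    rowMinor (W.map φ) s = φ (rowMinor W s) := by
  rw [rowMinor, rowMinor, RingHom.map_det]
  rfl

theorem rowMinor_mul {R : Type*} [CommRing R] {N k : ℕ}
    (W : Matrix (Fin N) (Fin k) R) (B : Matrix (Fin k) (Fin k) R) (s : Fin k → Fin N) :
    rowMinor (W * B) s = rowMinor W s * B.det := by
  rw [rowMinor, rowMinor, ← Matrix.det_mul]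
  rfl

theorem det_lowRankBlock_ne_zero (r : ℕ) : (lowRankBlock F m n r).det ≠ 0 := by
  have h := rowMinor_sparseGenericMatrix (R := F) (fun (c : Fin (n + m)) (i : Fin m) =>
    n ≤ (c : ℕ) ∨ (i : ℕ) < r) (Fin.natAdd n) (Fin.strictMono_natAdd n) (by simp)
  have hdet : (lowRankBlock F m n r).det = algebraMap _ (LowRankField F m n)
      (rowMinor (lowRankGenericMatrix F m n r) (Fin.natAdd n)) :=
    rowMinor_map _ _ _
  rw [hdet]
  exact (map_ne_zero_iff _ (IsFractionRing.injective _ _)).2 h.ne_zero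

theorem stackedGenericMatrix_map (r : ℕ) :
    (stackedGenericMatrix F m n).map (lowRankEval F m n r : _ →+* LowRankField F m n) =
      lowRankFieldMatrix F m n r * (lowRankBlock F m n r)⁻¹ := by
  ext c i
  refine Fin.addCases (fun j => ?_) (fun k => ?_) c
  · simp [stackedGenericMatrix, lowRankEval]
  · have h : lowRankBlock F m n r * (lowRankBlock F m n r)⁻¹ = 1 :=
      Matrix.mul_nonsing_inv _ (isUnit_iff_ne_zero.2 (det_lowRankBlock_ne_zero r))
    have h' : (lowRankFieldMatrix F m n r * (lowRankBlock F m n r)⁻¹) (Fin.natAdd n k) i =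
        (1 : Matrix (Fin m) (Fin m) _) k i := by
      rw [← h]
      rfl
    rw [h', Matrix.one_apply]
    by_cases hki : k = i <;> simp [stackedGenericMatrix, hki]

theorem lowRankEval_rowMinor (r : ℕ) (s : Fin m → Fin (n + m)) :
    lowRankEval F m n r (rowMinor (stackedGenericMatrix F m n) s) =
      algebraMap _ _ (rowMinor (lowRankGenericMatrix F m n r) s) *
        (lowRankBlock F m n r)⁻¹.det := by
  have h := rowMinor_map (lowRankEval F m n r : _ →+* LowRankField F m n)
    (stackedGenericMatrix F m n) s
  rw [stackedGenericMatrix_map, rowMinor_mul, lowRankFieldMatrix, rowMinor_map] at h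
  exact h.symm

theorem lowRankEval_minor {r t : ℕ} (hrt : r < t) (f : Fin t → Fin m) (g : Fin t → Fin n) :
    lowRankEval F m n r (Matrix.det ((Matrix.of fun i j =>
      (MvPolynomial.X (i, j) : MvPolynomial (Fin m × Fin n) F)).submatrix f g)) = 0 := by
  rw [← AlgHom.coe_toRingHom, RingHom.map_det, ← Matrix.det_transpose]
  have h := det_submatrix_mul_eq_zero (r := r) (ι := Fin t) (by simpa using hrt)
    ((lowRankFieldMatrix F m n r).submatrix (Fin.castAdd m) id) (lowRankBlock F m n r)⁻¹
    (fun c i hi => by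
      simp [lowRankFieldMatrix, lowRankGenericMatrix, sparseGenericMatrix, not_lt.2 hi]) g f
  rw [← h]
  congr 1
  ext a b
  simp [lowRankEval, Matrix.mul_apply]

theorem mem_span_prod_rowMinor (f : MvPolynomial (Fin m × Fin n) F) :
    ∃ d : ℕ, f ∈ Submodule.span F (Set.range fun T : Fin d → Fin m → Fin (n + m) =>
      ∏ j, rowMinor (stackedGenericMatrix F m n) (T j)) := by
  set V : Submodule F (MvPolynomial (Fin m × Fin n) F) :=
    Submodule.span F (Set.range (rowMinor (stackedGenericMatrix F m n))) with hV
  have hone : (1 : Submodule F (MvPolynomial (Fin m × Fin n) F)) ≤ V := by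
    rw [Submodule.one_le]
    refine Submodule.subset_span ⟨Fin.natAdd n, ?_⟩
    have : (stackedGenericMatrix F m n).submatrix (Fin.natAdd n) id = 1 := by
      ext k i
      simp [stackedGenericMatrix, Matrix.one_apply]
    rw [rowMinor, this, Matrix.det_one]
  have hX : ∀ x, MvPolynomial.X x ∈ V := by
    rintro ⟨i, j⟩
    refine Submodule.subset_span
      ⟨Function.update (Fin.natAdd n) i (Fin.castAdd m j), ?_⟩
    have hsub : (stackedGenericMatrix F m n).submatrix
        (Function.update (Fin.natAdd n) i (Fin.castAdd m j)) id =
        (1 : Matrix (Fin m) (Fin m) _).updateRow i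
          (stackedGenericMatrix F m n (Fin.castAdd m j)) := by
      ext k l
      by_cases hk : k = i
      · subst hk
        simp
      · simp [hk, stackedGenericMatrix, Matrix.one_apply]
    rw [rowMinor, hsub, ← Matrix.cramer_transpose_apply, Matrix.transpose_one, Matrix.cramer_one]
    simp [stackedGenericMatrix]
  have hpow : ∀ d, V ^ d = Submodule.span F (Set.range fun T : Fin d → Fin m → Fin (n + m) =>
      ∏ j, rowMinor (stackedGenericMatrix F m n) (T j)) := by
    intro d
    rw [hV, Submodule.span_pow]
    congr 1
    ext x
    rw [Set.mem_pow_iff_prod]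
    constructor
    · rintro ⟨p, hp, rfl⟩
      choose T hT using hp
      exact ⟨T, by simp [hT]⟩
    · rintro ⟨T, rfl⟩
      exact ⟨_, fun j => ⟨T j, rfl⟩, rfl⟩
  simp_rw [← hpow]
  induction f using MvPolynomial.induction_on with
  | C a =>
    refine ⟨0, ?_⟩
    rw [pow_zero]
    exact Submodule.mem_one.2 ⟨a, rfl⟩
  | add p q hp hq =>
    obtain ⟨d, hd⟩ := hp
    obtain ⟨e, he⟩ := hq
    exact ⟨max d e, add_mem (pow_le_pow_right' hone (le_max_left d e) hd)
      (pow_le_pow_right' hone (le_max_right d e) he)⟩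
  | mul_X p x hp =>
    obtain ⟨d, hd⟩ := hp
    exact ⟨d + 1, by rw [pow_succ]; exact Submodule.mul_mem_mul hd (hX x)⟩

theorem rowMinor_mem_detIdeal {t : ℕ} (ht : t ≤ m) (s : Fin m → Fin (n + m))
    (hs : StrictMono s) (hlt : ∀ i : Fin m, (i : ℕ) < t → (s i : ℕ) < n) :
    rowMinor (stackedGenericMatrix F m n) s ∈ detIdeal (Matrix.of fun i j =>
      (MvPolynomial.X (i, j) : MvPolynomial (Fin m × Fin n) F)) (t : ℤ) := by
  refine det_mem_of_minors_mem _ _ ht fun f => ?_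
  by_cases hf : Function.Injective f
  swap
  · simp only [Function.Injective, not_forall] at hf
    obtain ⟨a, b, hab, hne⟩ := hf
    rw [Matrix.det_zero_of_column_eq hne fun k => by simp [hab]]
    exact Ideal.zero_mem _
  let g : Fin t → Fin n := fun a => ⟨s (Fin.castLE ht a), hlt _ a.2⟩
  have hg : Function.Injective g := fun a b hab =>
    Fin.castLE_injective ht (hs.injective (Fin.ext (by simpa [g] using hab)))
  refine Ideal.subset_span ⟨f, g, hf, hg, ?_⟩
  rw [← Matrix.det_transpose]
  congr 1
  ext a b
  have : s (Fin.castLE ht b) = Fin.castAdd m (g b) := rfl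
  simp [this, stackedGenericMatrix]

theorem ker_lowRankEval_eq_detIdeal {r : ℕ} (hr : r < m) :
    RingHom.ker (lowRankEval F m n r) = detIdeal (Matrix.of fun i j =>
      (MvPolynomial.X (i, j) : MvPolynomial (Fin m × Fin n) F)) ((r + 1 : ℕ) : ℤ) := by
  set I := detIdeal (Matrix.of fun i j =>
    (MvPolynomial.X (i, j) : MvPolynomial (Fin m × Fin n) F)) ((r + 1 : ℕ) : ℤ) with hI
  have hle : I ≤ RingHom.ker (lowRankEval F m n r) := by
    rw [hI, detIdeal, Ideal.span_le]
    rintro _ ⟨f, g, -, -, rfl⟩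
    exact lowRankEval_minor (Nat.lt_succ_self r) f g
  refine le_antisymm (fun f hf => ?_) hle
  obtain ⟨d, hd⟩ := mem_span_prod_rowMinor f
  let ι := {T : Fin d → Fin m → Fin (n + m) //
    (Monotone T ∧ ∀ j, StrictMono (T j)) ∧ ∀ j, n ≤ (T j ⟨r, hr⟩ : ℕ)}
  let p : ι → MvPolynomial (Fin m × Fin n) F := fun T =>
    ∏ j, rowMinor (stackedGenericMatrix F m n) (T.1 j)
  let q : ι → MvPolynomial (Fin (n + m) × Fin m) F := fun T =>
    ∏ j, rowMinor (lowRankGenericMatrix F m n r) (T.1 j)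
  have hstd : f ∈ I.restrictScalars F ⊔ Submodule.span F (Set.range p) := by
    refine (Submodule.span_le.2 ?_) hd
    rintro _ ⟨T, rfl⟩
    refine prod_rowMinor_mem (stackedGenericMatrix F m n)
      (I.restrictScalars F ⊔ Submodule.span F (Set.range p)).toAddSubgroup
      (fun T hT hTs => ?_) T
    by_cases hbig : ∀ j, n ≤ (T j ⟨r, hr⟩ : ℕ)
    · exact Submodule.mem_sup_right (Submodule.subset_span ⟨⟨T, ⟨hT, hTs⟩, hbig⟩, rfl⟩)
    · push Not at hbig
      obtain ⟨j, hj⟩ := hbig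
      refine Submodule.mem_sup_left ?_
      refine I.mem_of_dvd (Finset.dvd_prod_of_mem _ (Finset.mem_univ j)) ?_
      refine rowMinor_mem_detIdeal (by omega) _ (hTs j) fun i hi => lt_of_le_of_lt ?_ hj
      exact (hTs j).monotone (show (i : ℕ) ≤ r by omega)
  have hlin : LinearIndependent F q := by
    refine HasInitialMonomial.linearIndependent
      (μ := fun T : ι => ∑ j, ∑ i, Finsupp.single (T.1 j i, i) 1)
      (w := fun x : Fin (n + m) × Fin m => (x.1 : ℕ) * x.2) (fun T => ?_) ?_
    · refine HasInitialMonomial.prod _ fun j _ =>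
        rowMinor_sparseGenericMatrix _ _ (T.2.1.2 j) fun i => ?_
      by_cases hi : (i : ℕ) < r
      · exact Or.inr hi
      · exact Or.inl ((T.2.2 j).trans
          ((T.2.1.2 j).monotone (show r ≤ (i : ℕ) by omega)))
    · intro T T' h
      exact Subtype.ext (chain_exponent_injective T.2.1.1 T'.2.1.1 h)
  obtain ⟨g, hg, h, hh, rfl⟩ := Submodule.mem_sup.1 hstd
  have : Fintype ι := Fintype.ofFinite ι
  obtain ⟨c, rfl⟩ := (Submodule.mem_span_range_iff_exists_fun F).1 hh
  have heval : ∀ T, lowRankEval F m n r (p T) =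
      algebraMap _ _ (q T) * (lowRankBlock F m n r)⁻¹.det ^ d := by
    intro T
    simp only [p, q, map_prod, lowRankEval_rowMinor, Finset.prod_mul_distrib]
    simp
  have hzero : lowRankEval F m n r (∑ T, c T • p T) = 0 := by
    have h1 : lowRankEval F m n r g = 0 := hle hg
    have h2 : lowRankEval F m n r (g + ∑ T, c T • p T) = 0 := hf
    rwa [map_add, h1, zero_add] at h2
  have hsum : lowRankEval F m n r (∑ T, c T • p T) =
      algebraMap _ (LowRankField F m n) (∑ T, c T • q T) *
        (lowRankBlock F m n r)⁻¹.det ^ d := by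
    rw [map_sum, map_sum, Finset.sum_mul]
    refine Finset.sum_congr rfl fun T _ => ?_
    rw [map_smul, heval, ← smul_mul_assoc, Algebra.smul_def, Algebra.smul_def,
      IsScalarTower.algebraMap_apply F (MvPolynomial (Fin (n + m) × Fin m) F), map_mul]
  have hdet : (lowRankBlock F m n r)⁻¹.det ^ d ≠ 0 := by
    refine pow_ne_zero _ ?_
    rw [Matrix.det_nonsing_inv]
    rw [Ring.inverse_eq_inv]
    exact inv_ne_zero (det_lowRankBlock_ne_zero r)
  rw [hsum, mul_eq_zero, or_iff_left hdet,
    map_eq_zero_iff _ (IsFractionRing.injective _ _)] at hzero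
  have hc := Fintype.linearIndependent_iff.1 hlin c hzero
  simpa [hc] using hg

end Determinantal

/-- Over the polynomial ring `R = F[x_{ij}]` in `m * n` variables over a field `F`, with
`X` the generic `m × n` matrix whose `(i, j)` entry is the variable `x_{ij}`, and
`1 ≤ t ≤ min m n`, the determinantal ideal `I_t(X)` is a prime ideal; in particular its
zero locus in `Spec R` is an irreducible closed subset. -/
theorem detIdeal_genericMatrix_isPrime
    (F : Type*) [Field F] {m n : ℕ} (hm : 1 ≤ m) (hn : 1 ≤ n)
    (t : ℕ) (ht1 : 1 ≤ t) (ht2 : t ≤ min m n) :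
    letI R := MvPolynomial (Fin m × Fin n) F
    letI X : Matrix (Fin m) (Fin n) R := Matrix.of fun i j => MvPolynomial.X (i, j)
    (detIdeal X (t : ℤ)).IsPrime ∧
      IsIrreducible (PrimeSpectrum.zeroLocus (R := R) (detIdeal X (t : ℤ) : Set R)) ∧
      IsClosed (PrimeSpectrum.zeroLocus (R := R) (detIdeal X (t : ℤ) : Set R)) := by
  obtain ⟨r, rfl⟩ : ∃ r, t = r + 1 := ⟨t - 1, by omega⟩
  have hprime : (detIdeal (Matrix.of fun i j =>
      (MvPolynomial.X (i, j) : MvPolynomial (Fin m × Fin n) F)) ((r + 1 : ℕ) : ℤ)).IsPrime := by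
    rw [← ker_lowRankEval_eq_detIdeal (by omega)]
    exact RingHom.ker_isPrime _
  exact ⟨hprime, (PrimeSpectrum.isIrreducible_zeroLocus_iff_of_radical _ hprime.isRadical).2 hprime,
    PrimeSpectrum.isClosed_zeroLocus _⟩
end

section
/- Let F be a field, let m, n ≥ 1, let R = MvPolynomial (Fin m × Fin n) F be the polynomial ring in mn variables x_{ij}, and let X be the generic m×n matrix over R whose (i,j) entry is the variable x_{ij}. Then for every integer t with 1 ≤ t ≤ min(m,n), the quotient ring R/I_t(X) is Cohen–Macaulay, i.e., its localization at every prime ideal is a Cohen–Macaulay local ring. -/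
/-- The depth of an ideal `I` in a commutative ring `R`: the supremum of the lengths of
regular sequences on `R` all of whose entries lie in `I`. -/
noncomputable def idealDepth {R : Type*} [CommRing R] (I : Ideal R) : ℕ∞ :=
  ⨆ (rs : List R) (_ : (∀ x ∈ rs, x ∈ I) ∧ RingTheory.Sequence.IsRegular R rs),
    (rs.length : ℕ∞)

/-- A commutative ring is a Cohen–Macaulay local ring if it is local and its depth (the
depth of its maximal ideal) equals its Krull dimension. -/
def IsCMLocalRing (R : Type*) [CommRing R] : Prop :=
  IsLocalRing R ∧ ∀ M : Ideal R, M.IsMaximal → (idealDepth M : WithBot ℕ∞) = ringKrullDim R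

universe u

section

open CategoryTheory Abelian

/-- The groups `Ext^i(R ⧸ Q, M)` vanish for all primes `Q` and all `i < height Q - c`. For the cyclic
module `M = R ⧸ I` with `I` of height `c`, this says that `M` is Cohen–Macaulay. -/
def HasCodepthLE {R : Type u} [CommRing R] (c : ℕ) (M : ModuleCat.{u} R) : Prop :=
  ∀ (Q : Ideal R) [Q.IsPrime] (i : ℕ), ((i + c : ℕ) : ℕ∞) < Q.height →
    Subsingleton (Ext (ModuleCat.of R (R ⧸ Q)) M i)

namespace HasCodepthLE

variable {R : Type u} [CommRing R] {c : ℕ}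

lemma of_iso {M N : ModuleCat.{u} R} (e : M ≅ N) (h : HasCodepthLE c M) : HasCodepthLE c N := by
  intro Q _ i hi
  have := h Q i hi
  have e' : Ext (ModuleCat.of R (R ⧸ Q)) N i ≃ Ext (ModuleCat.of R (R ⧸ Q)) M i :=
    ((extFunctorObj (ModuleCat.of R (R ⧸ Q)) i).mapIso e).addCommGroupIsoToAddEquiv.symm.toEquiv
  exact e'.subsingleton

lemma of_shortExact_left {S : ShortComplex (ModuleCat.{u} R)} (hS : S.ShortExact)
    (h₂ : HasCodepthLE c S.X₂) (h₃ : HasCodepthLE (c + 1) S.X₃) : HasCodepthLE c S.X₁ := by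
  intro Q _ i hi
  have z2 := AddCommGrpCat.isZero_of_iff_subsingleton.mpr (h₂ Q i hi)
  obtain _ | i := i
  · have := h₂ Q 0 hi
    have hmono := hS.mono_f
    refine ⟨fun a b => ?_⟩
    apply Ext.addEquiv₀.injective
    rw [← cancel_mono S.f]
    exact (Ext.addEquiv₀.symm.injective (Subsingleton.elim _ _))
  · have z3 := AddCommGrpCat.isZero_of_iff_subsingleton.mpr
      (h₃ Q i (by convert hi using 2; omega))
    exact AddCommGrpCat.subsingleton_of_isZero <| ShortComplex.Exact.isZero_of_both_zeros
      ((Ext.covariant_sequence_exact₁' (ModuleCat.of R (R ⧸ Q)) hS) i (i + 1) rfl)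
      (z3.eq_zero_of_src _) (z2.eq_zero_of_tgt _)

lemma of_shortExact_right {S : ShortComplex (ModuleCat.{u} R)} (hS : S.ShortExact)
    (h₁ : HasCodepthLE c S.X₁) (h₂ : HasCodepthLE c S.X₂) : HasCodepthLE (c + 1) S.X₃ := by
  intro Q _ i hi
  have z2 := AddCommGrpCat.isZero_of_iff_subsingleton.mpr
    (h₂ Q i (lt_of_le_of_lt (by norm_cast; omega) hi))
  have z1 := AddCommGrpCat.isZero_of_iff_subsingleton.mpr
    (h₁ Q (i + 1) (by convert hi using 2; omega))
  exact AddCommGrpCat.subsingleton_of_isZero <| ShortComplex.Exact.isZero_of_both_zeros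
    ((Ext.covariant_sequence_exact₃' (ModuleCat.of R (R ⧸ Q)) hS) i (i + 1) rfl)
    (z2.eq_zero_of_src _) (z1.eq_zero_of_tgt _)

lemma eq_zero_of_smul_eq_zero [IsNoetherianRing R] {M : ModuleCat.{u} R} (h : HasCodepthLE c M)
    {C : Ideal R} (hC : (c : ℕ∞) < C.height) {u : M} (hu : ∀ r ∈ C, r • u = 0) : u = 0 := by
  by_contra hne
  obtain ⟨Q, hQ, hle⟩ := exists_le_isAssociatedPrime_of_isNoetherianRing R u hne
  have hCQ : C ≤ Q := fun r hr => hle (Submodule.mem_colon_singleton.mpr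
    ((Submodule.mem_bot R).mpr (hu r hr)))
  have hp := hQ.isPrime
  have hs := h Q 0 (lt_of_lt_of_le (by simpa using hC) (Ideal.height_mono hCQ))
  have : Subsingleton (R ⧸ Q →ₗ[R] M) :=
    (Ext.addEquiv₀.trans (ModuleCat.homAddEquiv
      (M := ModuleCat.of R (R ⧸ Q)) (N := M))).symm.subsingleton
  obtain ⟨f, hf⟩ := (isAssociatedPrime_iff_exists_injective_linearMap _ _).mp hQ |>.2
  have : f 1 = 0 := by rw [Subsingleton.elim f 0]; rfl
  have h1 : (1 : R ⧸ Q) = 0 := hf (by simpa using this)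
  exact one_ne_zero h1

lemma exists_isRegular [IsNoetherianRing R] {I : Ideal R}
    (h : HasCodepthLE c (ModuleCat.of R (R ⧸ I))) (Q : Ideal R) [Q.IsPrime] (hIQ : I ≤ Q)
    {n : ℕ} (hn : ((n + c : ℕ) : ℕ∞) ≤ Q.height) :
    ∃ rs : List R, rs.length = n ∧ (∀ r ∈ rs, r ∈ Q) ∧
      RingTheory.Sequence.IsRegular (R ⧸ I) rs := by
  refine ModuleCat.exists_isRegular_of_exists_subsingleton_ext Q n (ModuleCat.of R (R ⧸ I)) ?_
    (ModuleCat.of R (R ⧸ Q)) ?_ fun i hi => h Q i (lt_of_lt_of_le (by norm_cast; omega) hn)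
  · rw [lt_top_iff_ne_top]
    intro htop
    have h1 : (1 : R ⧸ I) ∈ Q • (⊤ : Submodule R (R ⧸ I)) := by
      have : (1 : R ⧸ I) ∈ (⊤ : Submodule R (R ⧸ I)) := trivial
      rwa [← htop] at this
    have h2 : Q • (⊤ : Submodule R (R ⧸ I)) ≤ Submodule.map I.mkQ Q := by
      rw [Submodule.smul_le]
      intro r hr x _
      obtain ⟨x, rfl⟩ := Submodule.Quotient.mk_surjective _ x
      exact ⟨r * x, Q.mul_mem_right _ hr, rfl⟩
    obtain ⟨q, hq, hq1⟩ := h2 h1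
    have h3 : q - 1 ∈ I := Ideal.Quotient.eq.mp hq1
    exact (Ideal.ne_top_iff_one Q).mp (Ideal.IsPrime.ne_top ‹_›)
      (by simpa using Q.sub_mem hq (hIQ h3))
  · rw [Module.support_eq_zeroLocus, Ideal.annihilator_quotient]

end HasCodepthLE

end

section

open CategoryTheory Abelian RingTheory.Sequence

open scoped Polynomial

namespace HasCodepthLE

variable {R : Type u} [CommRing R] {c : ℕ}

lemma quotSMulTop {M : ModuleCat.{u} R} (h : HasCodepthLE c M) {r : R}
    (hr : IsSMulRegular M r) : HasCodepthLE (c + 1) (ModuleCat.of R (QuotSMulTop r M)) :=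
  of_shortExact_right hr.smulShortComplex_shortExact h h

lemma quot_ofList_smul_top {rs : List R} : ∀ {c : ℕ} {M : ModuleCat.{u} R}, HasCodepthLE c M →
    IsWeaklyRegular M rs →
    HasCodepthLE (c + rs.length)
      (ModuleCat.of R (M ⧸ (Ideal.ofList rs • ⊤ : Submodule R M))) := by
  induction rs with
  | nil =>
    intro c M h _
    refine h.of_iso (LinearEquiv.toModuleIso ?_)
    exact (Submodule.quotEquivOfEqBot _ (by simp)).symm
  | cons r rs ih =>
    intro c M h hreg
    rw [isWeaklyRegular_cons_iff] at hreg
    have h1 := ih (h.quotSMulTop hreg.1) hreg.2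
    rw [List.length_cons, add_comm rs.length 1, ← add_assoc]
    exact h1.of_iso (LinearEquiv.toModuleIso
      (Submodule.quotOfListConsSMulTopEquivQuotSMulTopInner M r rs).symm)

end HasCodepthLE

namespace Polynomial

variable {A : Type u} [CommRing A]

/-- Multiplication by `F` is injective modulo the extension of `J` as soon as no nonzero element of
`A ⧸ J` is killed by all the coefficients of `F`. -/
lemma mem_map_C_of_mul_mem {J : Ideal A} {F : A[X]}
    (hF : ∀ u : A ⧸ J, (∀ i, F.coeff i • u = 0) → u = 0) {x : A[X]}
    (hx : F * x ∈ J.map C) : x ∈ J.map C := by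
  have key : ∀ y : A[X], y ∈ J.map C ↔ y.map (Ideal.Quotient.mk J) = 0 := by
    intro y
    rw [Ideal.mem_map_C_iff, Polynomial.ext_iff]
    simp [Ideal.Quotient.eq_zero_iff_mem]
  rw [key, Polynomial.map_mul] at hx
  rw [key]
  have hnz : F.map (Ideal.Quotient.mk J) ∈ nonZeroDivisors (A ⧸ J)[X] := by
    by_contra hno
    obtain ⟨a, ha, haF⟩ := Polynomial.notMem_nonZeroDivisors_iff.mp hno
    refine ha (hF a fun i => ?_)
    have := congrArg (fun p => p.coeff i) haF
    simp only [coeff_smul, coeff_map, coeff_zero, smul_eq_mul] at this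
    rw [Algebra.smul_def, mul_comm]
    exact this
  exact (mul_right_mem_nonZeroDivisors_eq_zero_iff hnz).mp (by rwa [mul_comm])

variable [IsNoetherianRing A]

attribute [local instance] Polynomial.algebra Polynomial.isLocalization in
lemma height_le_height_comap_C_add_one (P : Ideal A[X]) [P.IsPrime] :
    P.height ≤ (P.comap C).height + 1 := by
  set p := P.comap C with hp
  have : P.LiesOver p := ⟨rfl⟩
  let Rₚ := Localization.AtPrime p
  set p' : Ideal Rₚ := p.map (algebraMap A Rₚ) with p'_def
  have : p'.IsMaximal := by
    rw [p'_def, Localization.AtPrime.map_eq_maximalIdeal]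
    exact IsLocalRing.maximalIdeal.isMaximal Rₚ
  let P' : Ideal Rₚ[X] := P.map (algebraMap A[X] Rₚ[X])
  have disj : Disjoint (p.primeCompl.map C : Set A[X]) P := by
    refine Set.disjoint_left.mpr fun a ⟨b, hb⟩ ha ↦ hb.1 ?_
    rwa [SetLike.mem_coe, hp, Ideal.mem_comap, hb.2]
  have : P'.IsPrime := IsLocalization.isPrime_of_isPrime_disjoint (p.primeCompl.map C) _ _ ‹_› disj
  have : P'.LiesOver p' :=
    IsLocalization.liesOver_of_isPrime_of_disjoint p.primeCompl _ _ disj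
  have eq1 : p.height = p'.height := by
    rw [IsLocalization.height_map_of_disjoint p.primeCompl]
    exact Disjoint.symm <| Set.disjoint_left.mpr fun _ a b ↦ b a
  have eq2 : P.height = P'.height := by
    rw [IsLocalization.height_map_of_disjoint (Submonoid.map C <| p.primeCompl) _ disj]
  obtain ⟨M, hM, hPM⟩ := P'.exists_le_maximal (Ideal.IsPrime.ne_top ‹_›)
  have : M.LiesOver p' := ⟨by
    refine Ideal.IsMaximal.eq_of_le ‹_› (Ideal.IsPrime.ne_top inferInstance) ?_
    rw [Ideal.LiesOver.over (P := P') (p := p')]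
    exact Ideal.comap_mono hPM⟩
  rw [eq1, eq2, ← height_eq_height_add_one p' M]
  exact Ideal.height_mono hPM

lemma height_le_height_comap_C (P : Ideal A[X]) [P.IsPrime] (h : P = (P.comap C).map C) :
    P.height ≤ (P.comap C).height := by
  have : P.LiesOver (P.comap C) := ⟨rfl⟩
  refine (Ideal.height_le_height_add_of_liesOver (P.comap C) P).trans ?_
  have h0 : P.map (Ideal.Quotient.mk ((P.comap C).map (algebraMap A A[X]))) = ⊥ := by
    rw [Ideal.map_eq_bot_iff_le_ker, Ideal.mk_ker]
    exact h.le
  have : Nontrivial (A[X] ⧸ (P.comap C).map (algebraMap A A[X])) := by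
    rw [Ideal.Quotient.nontrivial_iff]
    intro h'
    exact (Ideal.IsPrime.ne_top ‹_› : P ≠ ⊤) (h.trans h')
  rw [h0, Ideal.height_bot, add_zero]

end Polynomial

end

section

open CategoryTheory Abelian RingTheory.Sequence

open scoped Polynomial

/-- Every prime ideal of `A` contains a weakly regular sequence at least as long as its height. -/
def HasLongRegularSequences (A : Type*) [CommRing A] : Prop :=
  ∀ (Q : Ideal A) [Q.IsPrime], ∃ rs : List A, Q.height ≤ rs.length ∧ (∀ r ∈ rs, r ∈ Q) ∧
    IsWeaklyRegular A rs

namespace HasLongRegularSequences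

lemma of_field (K : Type*) [Field K] : HasLongRegularSequences K := by
  intro Q _
  refine ⟨[], ?_, by simp, IsWeaklyRegular.nil K K⟩
  rw [Ideal.eq_bot_of_prime Q, Ideal.height_bot]
  simp

lemma of_ringEquiv {A B : Type*} [CommRing A] [CommRing B] (e : A ≃+* B)
    (h : HasLongRegularSequences A) : HasLongRegularSequences B := by
  intro Q _
  obtain ⟨rs, hrs, hmem, hreg⟩ := h (Q.comap e)
  refine ⟨rs.map e, ?_, ?_, ?_⟩
  · rwa [List.length_map, ← RingEquiv.height_comap e]
  · simpa using hmem
  · refine (e.toAddEquiv.isWeaklyRegular_congr ?_).mp hreg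
    exact List.forall₂_map_right_iff.mpr <| List.forall₂_same.mpr fun r _ x => map_mul e r x

lemma exists_length_eq {A : Type*} [CommRing A] [IsNoetherianRing A]
    (h : HasLongRegularSequences A) (Q : Ideal A) [Q.IsPrime] : ∃ rs : List A,
    Q.height = rs.length ∧ (∀ r ∈ rs, r ∈ Q) ∧ IsWeaklyRegular A rs := by
  obtain ⟨rs, hrs, hmem, hreg⟩ := h Q
  obtain ⟨k, hk⟩ := ENat.ne_top_iff_exists.mp (Ideal.height_ne_top (I := Q) (Ideal.IsPrime.ne_top ‹_›))
  rw [← hk, Nat.cast_le] at hrs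
  refine ⟨rs.take k, by rw [← hk, List.length_take, min_eq_left hrs],
    fun r hr => hmem r (List.mem_of_mem_take hr), ?_⟩
  rw [← List.take_append_drop k rs, isWeaklyRegular_append_iff] at hreg
  exact hreg.1

lemma hasCodepthLE {A : Type u} [CommRing A] [IsNoetherianRing A]
    (h : HasLongRegularSequences A) : HasCodepthLE 0 (ModuleCat.of A A) := by
  intro Q _ i hi
  obtain ⟨rs, hrs, hmem, hreg⟩ := h Q
  have hQ : Q ≠ ⊤ := Ideal.IsPrime.ne_top ‹_›
  have hlt : Q • (⊤ : Submodule A A) < ⊤ := by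
    rw [Ideal.smul_top_eq_map, lt_top_iff_ne_top]
    simpa using hQ
  refine ModuleCat.subsingleton_ext_of_exists_isRegular Q (ModuleCat.of A (A ⧸ Q)) ?_
    (ModuleCat.of A A) hlt rs hmem ⟨hreg, ?_⟩ i ?_
  · rw [Module.support_eq_zeroLocus, Ideal.annihilator_quotient]
  · intro htop
    refine hlt.ne (top_le_iff.mp (htop.trans_le (Submodule.smul_mono_left ?_)))
    exact Ideal.span_le.mpr hmem
  · exact_mod_cast hi.trans_le hrs

open Polynomial in
lemma polynomial {A : Type u} [CommRing A] [IsNoetherianRing A]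
    (h : HasLongRegularSequences A) : HasLongRegularSequences A[X] := by
  intro P _
  set q := P.comap (C : A →+* A[X]) with hq
  obtain ⟨rs, hrs, hmem, hreg⟩ := h.exists_length_eq q
  have hreg' : IsWeaklyRegular A[X] (rs.map (C : A →+* A[X])) := hreg.of_flat (S := A[X])
  have hmem' : ∀ r ∈ rs.map (C : A →+* A[X]), r ∈ P := by
    simpa [hq, Ideal.mem_comap] using hmem
  by_cases hP : P = q.map C
  · exact ⟨rs.map C, by simpa [← hrs] using height_le_height_comap_C P hP, hmem', hreg'⟩
  obtain ⟨f, hfP, hf⟩ := SetLike.exists_of_lt (lt_of_le_of_ne Ideal.map_comap_le (Ne.symm hP))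
  obtain ⟨k, g, hg⟩ := Submodule.fg_iff_exists_fin_generating_family.mp q.fg_of_isNoetherianRing
  set N := f.natDegree + 1 with hN
  set f' : A[X] := f + X ^ N * ∑ i : Fin k, C (g i) * X ^ (i : ℕ) with hf'
  have hgq : ∀ i, g i ∈ q := fun i => hg ▸ Submodule.subset_span ⟨i, rfl⟩
  have hf'P : f' ∈ P := P.add_mem hfP <| P.mul_mem_left _ <| sum_mem fun i _ =>
    P.mul_mem_right _ (hgq i)
  set I := Ideal.span (Set.range f'.coeff) with hI
  have hlow : ∀ i < N, f'.coeff i = f.coeff i := by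
    intro i hi
    simp [f', coeff_X_pow_mul', hi.not_ge]
  have hhigh : ∀ i : Fin k, f'.coeff (N + i) = g i := by
    intro i
    have : f.coeff (i + N) = 0 := coeff_eq_zero_of_natDegree_lt (by omega)
    simp only [f', coeff_add, add_comm N (i : ℕ), this, zero_add, coeff_X_pow_mul, finsetSum_coeff,
      coeff_C_mul, coeff_X_pow, Fin.val_inj]
    simp
  have hlt : q < I := by
    refine lt_of_le_of_ne ?_ ?_
    · rw [← hg, Submodule.span_le]
      rintro _ ⟨i, rfl⟩
      exact Ideal.subset_span ⟨N + i, hhigh i⟩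
    · intro hqI
      refine hf (Ideal.mem_map_C_iff.mpr fun i => ?_)
      rw [← hq, hqI]
      rcases lt_or_ge i N with hi | hi
      · exact Ideal.subset_span ⟨i, hlow i hi⟩
      · rw [coeff_eq_zero_of_natDegree_lt (by omega)]
        exact zero_mem _
  have hht : ((0 + rs.length : ℕ) : ℕ∞) < I.height := by
    rw [zero_add, ← hrs]
    have : q.FiniteHeight := inferInstance
    exact Ideal.height_strict_mono_of_isPrime hlt
  have hann : ∀ u : A ⧸ Ideal.ofList rs, (∀ i, f'.coeff i • u = 0) → u = 0 := by
    intro u hu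
    have hcod := h.hasCodepthLE.quot_ofList_smul_top (rs := rs) hreg
    let e : (A ⧸ (Ideal.ofList rs • ⊤ : Submodule A A)) ≃ₗ[A] A ⧸ Ideal.ofList rs :=
      Submodule.quotEquivOfEq _ _ (by simp)
    refine (hcod.of_iso e.toModuleIso).eq_zero_of_smul_eq_zero hht (u := u) fun r hr => ?_
    have : I ≤ LinearMap.ker (LinearMap.toSpanSingleton A (A ⧸ Ideal.ofList rs) u) := by
      rw [hI, Ideal.span, Submodule.span_le]
      rintro _ ⟨i, rfl⟩
      exact hu i
    exact this hr
  refine ⟨rs.map C ++ [f'], ?_, ?_, ?_⟩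
  · simpa [← hrs] using height_le_height_comap_C_add_one P
  · intro r hr
    rcases List.mem_append.mp hr with hr | hr
    · exact hmem' r hr
    · rw [List.mem_singleton.mp hr]
      exact hf'P
  · rw [isWeaklyRegular_append_iff, isWeaklyRegular_singleton_iff]
    refine ⟨hreg', ?_⟩
    have hof : (Ideal.ofList (rs.map (C : A →+* A[X])) • ⊤ : Submodule A[X] A[X])
        = (Ideal.ofList rs).map C := by
      rw [smul_eq_mul, Ideal.mul_top, Ideal.map_ofList]
    rw [isSMulRegular_iff_right_eq_zero_of_smul]
    intro x hx
    obtain ⟨x, rfl⟩ := Submodule.Quotient.mk_surjective _ x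
    rw [← Submodule.Quotient.mk_smul, Submodule.Quotient.mk_eq_zero, hof] at hx
    rw [Submodule.Quotient.mk_eq_zero, hof]
    exact mem_map_C_of_mul_mem hann hx

lemma mvPolynomial (K : Type u) [Field K] (ι : Type) [Finite ι] :
    HasLongRegularSequences (MvPolynomial ι K) := by
  induction ι using Finite.induction_empty_option with
  | of_equiv e H => exact H.of_ringEquiv (MvPolynomial.renameEquiv _ e).toRingEquiv
  | h_empty => exact (of_field K).of_ringEquiv (MvPolynomial.isEmptyRingEquiv K _).symm
  | h_option IH =>
    exact IH.polynomial.of_ringEquiv (MvPolynomial.optionEquivLeft _ _).toRingEquiv.symm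

end HasLongRegularSequences

end

section

open CategoryTheory Abelian

section Linkage

variable {R : Type u} [CommRing R] {ι : Type} (N : Ideal R) (q δ : ι → R)

/-- The relations modulo `N` between the elements of the family `δ`. -/
noncomputable def Ideal.relationsModulo : Submodule R (ι →₀ R) :=
  LinearMap.ker (N.mkQ ∘ₗ Finsupp.linearCombination R δ)

lemma Ideal.mem_relationsModulo {a : ι →₀ R} :
    a ∈ N.relationsModulo δ ↔ a.sum (fun i r => r * δ i) ∈ N := by
  rw [relationsModulo, LinearMap.mem_ker, LinearMap.comp_apply, Submodule.mkQ_apply,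
    Submodule.Quotient.mk_eq_zero, Finsupp.linearCombination_apply]
  rfl

/-- The short exact sequence `0 → I / N → R / N → R / I → 0`, where `I` is generated by `N` and the
family `δ`, with `I / N` presented by generators and relations. -/
noncomputable abbrev Ideal.supSpanShortComplex : ShortComplex (ModuleCat.{u} R) where
  X₁ := ModuleCat.of R ((ι →₀ R) ⧸ N.relationsModulo δ)
  X₂ := ModuleCat.of R (R ⧸ N)
  X₃ := ModuleCat.of R (R ⧸ N ⊔ Ideal.span (Set.range δ))
  f := ModuleCat.ofHom ((N.relationsModulo δ).liftQ _ le_rfl)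
  g := ModuleCat.ofHom (Submodule.factor le_sup_left)
  zero := by
    ext i
    simp only [ModuleCat.hom_comp, ModuleCat.hom_ofHom, ModuleCat.hom_zero]
    refine (Submodule.Quotient.mk_eq_zero _).mpr (le_sup_right (a := N) ?_)
    simpa using Ideal.subset_span (Set.mem_range_self i)

lemma Ideal.supSpanShortComplex_shortExact : (N.supSpanShortComplex δ).ShortExact := by
  refine ModuleCat.shortComplex_shortExact _ ?_ ?_ ?_
  · refine fun x => ⟨fun hx => ?_, ?_⟩
    · obtain ⟨x, rfl⟩ := Submodule.Quotient.mk_surjective _ x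
      have hx' : x ∈ N ⊔ Ideal.span (Set.range δ) := (Submodule.Quotient.mk_eq_zero _).mp hx
      obtain ⟨y, hy, z, hz, rfl⟩ := Submodule.mem_sup.mp hx'
      obtain ⟨a, rfl⟩ := (Finsupp.mem_ideal_span_range_iff_exists_finsupp).mp hz
      refine ⟨Submodule.Quotient.mk a, ?_⟩
      refine ((Submodule.Quotient.eq N).mpr ?_).symm
      simpa [Finsupp.linearCombination_apply] using hy
    · rintro ⟨y, rfl⟩
      exact ConcreteCategory.congr_hom (N.supSpanShortComplex δ).zero y
  · rw [← LinearMap.ker_eq_bot]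
    exact Submodule.ker_liftQ_eq_bot _ _ _ le_rfl
  · exact Submodule.factor_surjective (le_sup_left : N ≤ N ⊔ Ideal.span (Set.range δ))

variable {N q δ}

lemma Ideal.relationsModulo_le (hrel : ∀ i j, δ i * q j - δ j * q i ∈ N)
    (hδ : ∀ u, (∀ i, δ i * u ∈ N) → u ∈ N) : N.relationsModulo δ ≤ N.relationsModulo q := by
  intro a ha
  rw [mem_relationsModulo] at ha ⊢
  refine hδ _ fun j => ?_
  have h1 : δ j * a.sum (fun i r => r * q i) - q j * a.sum (fun i r => r * δ i) ∈ N := by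
    rw [Finsupp.mul_sum, Finsupp.mul_sum, Finsupp.sum, Finsupp.sum, ← Finset.sum_sub_distrib]
    refine Submodule.sum_mem _ fun i _ => ?_
    convert N.mul_mem_left (a i) (hrel j i) using 1
    ring
  simpa using N.add_mem h1 (N.mul_mem_left (q j) ha)

lemma HasCodepthLE.mem_of_forall_mul_mem [IsNoetherianRing R] {c : ℕ}
    (hN : HasCodepthLE c (ModuleCat.of R (R ⧸ N)))
    (hq : ((c + 1 : ℕ) : ℕ∞) ≤ (N ⊔ Ideal.span (Set.range q)).height) (u : R)
    (hu : ∀ i, q i * u ∈ N) : u ∈ N := by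
  refine (Submodule.Quotient.mk_eq_zero N).mp
    (hN.eq_zero_of_smul_eq_zero (u := Submodule.Quotient.mk u)
      (lt_of_lt_of_le (by norm_cast; omega) hq) fun r hr => ?_)
  rw [← Submodule.Quotient.mk_smul]
  refine (Submodule.Quotient.mk_eq_zero N).mpr ?_
  have : N ⊔ Ideal.span (Set.range q) ≤ LinearMap.ker (N.mkQ ∘ₗ LinearMap.toSpanSingleton R R u) := by
    refine sup_le (fun x hx => ?_) (Ideal.span_le.mpr ?_)
    · exact (Submodule.Quotient.mk_eq_zero N).mpr (N.mul_mem_right _ hx)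
    · rintro _ ⟨i, rfl⟩
      exact (Submodule.Quotient.mk_eq_zero N).mpr (hu i)
  exact (Submodule.Quotient.mk_eq_zero N).mp (this hr)

lemma Ideal.add_one_le_height_sup_span [IsNoetherianRing R] {c : ℕ} (hN : (c : ℕ∞) ≤ N.height)
    (hδ : ∀ u, (∀ i, δ i * u ∈ N) → u ∈ N) :
    ((c + 1 : ℕ) : ℕ∞) ≤ (N ⊔ Ideal.span (Set.range δ)).height := by
  rw [Ideal.height_eq_inf_minimalPrimes]
  refine le_iInf₂ fun P hP => ?_
  have := hP.isPrime
  by_contra! hlt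
  rw [Nat.cast_add, Nat.cast_one, ENat.lt_add_one_iff (ENat.natCast_ne_top c)] at hlt
  have hNP : N ≤ P := le_sup_left.trans hP.1.2
  have hmin := Ideal.mem_minimalPrimes_of_height_le hNP (hlt.trans hN)
  rw [← Ideal.annihilator_quotient (I := N)] at hmin
  obtain ⟨x, hx⟩ := (isAssociatedPrime_iff.mp
    (Module.associatedPrimes.minimalPrimes_annihilator_subset_associatedPrimes R (R ⧸ N) hmin)).2
  obtain ⟨u, rfl⟩ := Submodule.Quotient.mk_surjective _ x
  have hmem : ∀ r, r ∈ P ↔ r * u ∈ N := by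
    intro r
    rw [hx, Submodule.mem_colon_singleton, Submodule.mem_bot, ← Submodule.Quotient.mk_smul,
      Submodule.Quotient.mk_eq_zero, smul_eq_mul]
  have hu : u ∈ N := hδ u fun i =>
    (hmem _).mp (hP.1.2 (le_sup_right (a := N) (Ideal.subset_span ⟨i, rfl⟩)))
  exact P.ne_top_iff_one.mp this.ne_top ((hmem 1).mpr (by rwa [one_mul]))

theorem HasCodepthLE.sup_span [IsNoetherianRing R] {c : ℕ}
    (hN : HasCodepthLE c (ModuleCat.of R (R ⧸ N)))
    (hC : HasCodepthLE (c + 1) (ModuleCat.of R (R ⧸ N ⊔ Ideal.span (Set.range q))))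
    (hCht : ((c + 1 : ℕ) : ℕ∞) ≤ (N ⊔ Ideal.span (Set.range q)).height)
    (hrel : ∀ i j, δ i * q j - δ j * q i ∈ N) (hδ : ∀ u, (∀ i, δ i * u ∈ N) → u ∈ N) :
    HasCodepthLE (c + 1) (ModuleCat.of R (R ⧸ N ⊔ Ideal.span (Set.range δ))) := by
  have hker : N.relationsModulo δ = N.relationsModulo q := by
    refine le_antisymm (Ideal.relationsModulo_le hrel hδ)
      (Ideal.relationsModulo_le (fun i j => ?_) (hN.mem_of_forall_mul_mem hCht))
    convert N.neg_mem (hrel i j) using 1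
    ring
  have h := of_shortExact_left (N.supSpanShortComplex_shortExact q) hN hC
  refine of_shortExact_right (N.supSpanShortComplex_shortExact δ) ?_ hN
  exact h.of_iso (LinearEquiv.toModuleIso (Submodule.quotEquivOfEq _ _ hker.symm))

end Linkage

end

section

open scoped Polynomial

section LinearForms

variable {R : Type*} [CommRing R] {ι : Type*} {N : Ideal R} {q δ r : ι → R}

open Polynomial in
/-- If the `δ i` are linear in a variable not occurring in `N` and the leading coefficients `q i`
have no common annihilator modulo `N`, then neither do the `δ i`. -/
lemma Ideal.mem_of_forall_linear_mul_mem (ψ : R →+* R[X]) (y : R) (hψ : ∀ u, (ψ u).eval y = u)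
    (hN : N.map ψ ≤ N.map C) (hδ : ∀ i, ψ (δ i) = X * C (q i) + C (r i))
    (hq : ∀ u, (∀ i, q i * u ∈ N) → u ∈ N) (u : R) (hu : ∀ i, δ i * u ∈ N) : u ∈ N := by
  have key : ∀ p : R[X], p ∈ N.map C ↔ p.map (Ideal.Quotient.mk N) = 0 := by
    intro p
    rw [Ideal.mem_map_C_iff, Polynomial.ext_iff]
    simp [Ideal.Quotient.eq_zero_iff_mem]
  have hmem : ψ u ∈ N.map C := by
    rw [key]
    set p := (ψ u).map (Ideal.Quotient.mk N) with hp
    have hmul : ∀ i, (X * C (Ideal.Quotient.mk N (q i)) + C (Ideal.Quotient.mk N (r i))) * p = 0 := by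
      intro i
      have := (key _).mp (hN (Ideal.mem_map_of_mem ψ (hu i)))
      simpa [hδ] using this
    rw [← leadingCoeff_eq_zero]
    obtain ⟨v, hv⟩ := Ideal.Quotient.mk_surjective p.leadingCoeff
    rw [← hv, Ideal.Quotient.eq_zero_iff_mem]
    refine hq v fun i => ?_
    rw [← Ideal.Quotient.eq_zero_iff_mem, map_mul, hv]
    have h2 := congrArg (fun s => s.coeff (p.natDegree + 1)) (hmul i)
    simpa [add_mul, mul_assoc, coeff_X_mul, coeff_C_mul,
      coeff_eq_zero_of_natDegree_lt (Nat.lt_succ_self p.natDegree)] using h2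
  have hev : (N.map C).map (evalRingHom y) ≤ N := by
    rw [Ideal.map_map, Ideal.map_le_iff_le_comap]
    intro x hx
    simpa using hx
  have := hev (Ideal.mem_map_of_mem (evalRingHom y) hmem)
  simpa [hψ] using this

end LinearForms

namespace Matrix

variable {S : Type*} [CommRing S] {m n : Type*}

/-- Expansion of a determinant bordered by a first row and a first column. -/
lemma det_submatrix_cons (X : Matrix m n S) {s : ℕ} (a : m) (b : n) (A : Fin s → m)
    (B : Fin s → n) :
    (X.submatrix (Fin.cons a A : Fin (s + 1) → m) (Fin.cons b B : Fin (s + 1) → n)).det =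
      X a b * (X.submatrix A B).det -
        (fun j => X a (B j)) ⬝ᵥ ((X.submatrix A B).adjugate *ᵥ fun i => X (A i) b) := by
  rw [det_succ_column_zero, Fin.sum_univ_succ, sub_eq_add_neg]
  congr 1
  · simp
  · obtain _ | s := s
    · simp
    simp only [dotProduct, mulVec, Finset.mul_sum, ← Finset.sum_neg_distrib]
    rw [Finset.sum_comm]
    refine Finset.sum_congr rfl fun i _ => ?_
    rw [det_succ_row_zero, Finset.mul_sum]
    refine Finset.sum_congr rfl fun j _ => ?_
    have h : (((X.submatrix (Fin.cons a A : Fin (s + 1 + 1) → m)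
        (Fin.cons b B : Fin (s + 1 + 1) → n)).submatrix i.succ.succAbove Fin.succ).submatrix
        Fin.succ j.succAbove) = (X.submatrix A B).submatrix i.succAbove j.succAbove := by
      ext k l
      simp [Fin.removeNth]
    rw [h, adjugate_fin_succ_eq_det_submatrix]
    simp
    ring

/-- If the minors bordering `(A₂, B₂)` by rows of `A₁` and the column `b`, as well as those
bordering `(A₁, B₁)` by the row `a` and columns of `B₂` vanish, then the two minors
bordered by `a` and `b` are proportional to the unbordered ones. -/
lemma det_submatrix_cons_mul_det_submatrix (X : Matrix m n S) {s : ℕ} (a : m) (b : n)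
    (A₁ A₂ : Fin s → m) (B₁ B₂ : Fin s → n)
    (h₁ : ∀ i, (X.submatrix (Fin.cons (A₁ i) A₂ : Fin (s + 1) → m)
      (Fin.cons b B₂ : Fin (s + 1) → n)).det = 0)
    (h₂ : ∀ j, (X.submatrix (Fin.cons a A₁ : Fin (s + 1) → m)
      (Fin.cons (B₂ j) B₁ : Fin (s + 1) → n)).det = 0) :
    (X.submatrix (Fin.cons a A₁ : Fin (s + 1) → m) (Fin.cons b B₁ : Fin (s + 1) → n)).det *
        (X.submatrix A₂ B₂).det =
      (X.submatrix (Fin.cons a A₂ : Fin (s + 1) → m) (Fin.cons b B₂ : Fin (s + 1) → n)).det *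
        (X.submatrix A₁ B₁).det := by
  simp only [det_submatrix_cons, sub_eq_zero] at h₁ h₂ ⊢
  set d₁ := (X.submatrix A₁ B₁).det
  set d₂ := (X.submatrix A₂ B₂).det
  set K₁ := (X.submatrix A₁ B₁).adjugate
  set K₂ := (X.submatrix A₂ B₂).adjugate
  have e₁ : d₂ • (fun i => X (A₁ i) b) = X.submatrix A₁ B₂ *ᵥ (K₂ *ᵥ fun i => X (A₂ i) b) := by
    ext i
    rw [Pi.smul_apply, smul_eq_mul, mul_comm, h₁ i]
    rfl
  have e₂ : d₁ • (fun j => X a (B₂ j)) = (fun j => X a (B₁ j)) ᵥ* K₁ ᵥ* X.submatrix A₁ B₂ := by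
    ext j
    rw [Pi.smul_apply, smul_eq_mul, mul_comm, h₂ j, dotProduct_mulVec]
    rfl
  have e : d₁ * ((fun j => X a (B₂ j)) ⬝ᵥ (K₂ *ᵥ fun i => X (A₂ i) b)) =
      d₂ * ((fun j => X a (B₁ j)) ⬝ᵥ (K₁ *ᵥ fun i => X (A₁ i) b)) := by
    rw [← smul_eq_mul, ← smul_dotProduct, e₂, ← dotProduct_mulVec, ← e₁, dotProduct_smul,
      smul_eq_mul, ← dotProduct_mulVec]
  linear_combination e

end Matrix

end

section

namespace Matrix

variable {R : Type*} [CommRing R] {m n : ℕ} (X : Matrix (Fin m) (Fin n) R)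

/-- The ideal generated by the `t × t` minors of the upper left `a × b` block of `X`. -/
def minorIdeal (a b t : ℕ) : Ideal R :=
  Ideal.span {d | ∃ (f : Fin t → Fin m) (g : Fin t → Fin n),
    (∀ i, (f i : ℕ) < a) ∧ (∀ j, (g j : ℕ) < b) ∧ (X.submatrix f g).det = d}

variable {X} {a b t : ℕ}

lemma det_submatrix_mem_minorIdeal {f : Fin t → Fin m} {g : Fin t → Fin n}
    (hf : ∀ i, (f i : ℕ) < a) (hg : ∀ j, (g j : ℕ) < b) :
    (X.submatrix f g).det ∈ X.minorIdeal a b t :=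
  Ideal.subset_span ⟨f, g, hf, hg, rfl⟩

lemma minorIdeal_le {J : Ideal R} (h : ∀ (f : Fin t → Fin m) (g : Fin t → Fin n),
    (∀ i, (f i : ℕ) < a) → (∀ j, (g j : ℕ) < b) → (X.submatrix f g).det ∈ J) :
    X.minorIdeal a b t ≤ J := by
  refine Ideal.span_le.mpr ?_
  rintro _ ⟨f, g, hf, hg, rfl⟩
  exact h f g hf hg

variable (X) in
lemma minorIdeal_zero : X.minorIdeal a b 0 = ⊤ := by
  rw [Ideal.eq_top_iff_one, ← det_isEmpty (A := X.submatrix Fin.elim0 Fin.elim0)]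
  exact det_submatrix_mem_minorIdeal (fun i => i.elim0) fun i => i.elim0

variable (X) in
lemma minorIdeal_mono {a' b' : ℕ} (ha : a ≤ a') (hb : b ≤ b') :
    X.minorIdeal a b t ≤ X.minorIdeal a' b' t :=
  minorIdeal_le fun _ _ hf hg =>
    det_submatrix_mem_minorIdeal (fun i => (hf i).trans_le ha) fun j => (hg j).trans_le hb

variable (X a b t) in
lemma minorIdeal_transpose : Xᵀ.minorIdeal b a t = X.minorIdeal a b t := by
  refine le_antisymm (minorIdeal_le fun f g hf hg => ?_) (minorIdeal_le fun f g hf hg => ?_)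
  · rw [← det_transpose]
    exact det_submatrix_mem_minorIdeal hg hf
  · rw [← det_transpose]
    exact det_submatrix_mem_minorIdeal (X := Xᵀ) hg hf

variable (X a b t) in
lemma minorIdeal_succ_le : X.minorIdeal a (b + 1) (t + 1) ≤ X.minorIdeal a b t := by
  refine minorIdeal_le fun f g hf hg => ?_
  have key : ∀ j₀ : Fin (t + 1), (∀ j, (g (j₀.succAbove j) : ℕ) < b) →
      (X.submatrix f g).det ∈ X.minorIdeal a b t := by
    intro j₀ hj
    rw [det_succ_column _ j₀]
    refine Submodule.sum_mem _ fun i _ => Ideal.mul_mem_left _ _ ?_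
    rw [submatrix_submatrix]
    exact det_submatrix_mem_minorIdeal (fun k => hf _) hj
  by_cases h : ∃ j₀, b ≤ g j₀
  · obtain ⟨j₀, hj₀⟩ := h
    by_cases h' : ∃ j, b ≤ g (j₀.succAbove j)
    · obtain ⟨j, hj⟩ := h'
      rw [det_zero_of_column_eq (Fin.succAbove_ne j₀ j)]
      · exact zero_mem _
      · intro k
        have : g (j₀.succAbove j) = g j₀ := by
          have h1 := hg (j₀.succAbove j)
          have h2 := hg j₀
          omega
        simp [this]
    · push Not at h'
      exact key j₀ h'
  · push Not at h
    exact key 0 fun j => h _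

variable (X a b t) in
lemma minorIdeal_succ_le_left : X.minorIdeal (a + 1) b (t + 1) ≤ X.minorIdeal a b t := by
  rw [← minorIdeal_transpose, ← minorIdeal_transpose X a b t]
  exact minorIdeal_succ_le _ _ _ _

variable (X) in
lemma minorIdeal_add_le (k l : ℕ) : X.minorIdeal a (b + k) (t + k + l) ≤ X.minorIdeal a b t := by
  induction l with
  | zero =>
    induction k with
    | zero => rfl
    | succ k ih => exact (minorIdeal_succ_le X a (b + k) (t + k)).trans ih
  | succ l ih =>
    exact ((minorIdeal_mono X le_rfl (Nat.le_succ _)).trans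
      (minorIdeal_succ_le X a (b + k) (t + k + l))).trans ih

variable (X) in
lemma minorIdeal_le_minorIdeal {a' b' t' : ℕ} (hab : (a ≤ a' ∧ b' ≤ b) ∨ (a' ≤ a ∧ b ≤ b'))
    (ha : a + t' ≤ a' + t) (hb : b + t' ≤ b' + t) : X.minorIdeal a b t ≤ X.minorIdeal a' b' t' := by
  rcases hab with ⟨h₁, h₂⟩ | ⟨h₁, h₂⟩
  · obtain ⟨k, rfl⟩ := Nat.exists_eq_add_of_le h₂
    obtain ⟨l, rfl⟩ := Nat.exists_eq_add_of_le (show t' + k ≤ t by omega)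
    exact (minorIdeal_mono X h₁ le_rfl).trans (minorIdeal_add_le X k l)
  · obtain ⟨k, rfl⟩ := Nat.exists_eq_add_of_le h₁
    obtain ⟨l, rfl⟩ := Nat.exists_eq_add_of_le (show t' + k ≤ t by omega)
    rw [← minorIdeal_transpose, ← minorIdeal_transpose X a' b' t']
    exact (minorIdeal_mono Xᵀ h₂ le_rfl).trans (minorIdeal_add_le Xᵀ k l)

variable (X) in
lemma minorIdeal_eq_bot (h : a < t ∨ b < t) : X.minorIdeal a b t = ⊥ := by
  wlog hb : b < t generalizing m n a b
  · rw [← minorIdeal_transpose]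
    exact this Xᵀ h.symm (h.resolve_right hb)
  refine le_bot_iff.mp (minorIdeal_le fun f g hf hg => ?_)
  have hninj : ¬ Function.Injective fun j => (⟨g j, hg j⟩ : Fin b) := by
    intro hinj
    have := Fintype.card_le_of_injective _ hinj
    simp only [Fintype.card_fin] at this
    omega
  simp only [Function.Injective, Fin.mk.injEq, not_forall] at hninj
  obtain ⟨i, j, hij, hne⟩ := hninj
  refine (Submodule.mem_bot R).mpr (det_zero_of_column_eq hne fun k => ?_)
  simp [Fin.ext hij]

/-- Pairs of `t`-tuples of row and column indices of the upper left `a × b` block. -/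
abbrev BlockIndex (m n a b t : ℕ) : Type :=
  {p : (Fin t → Fin m) × (Fin t → Fin n) // (∀ i, (p.1 i : ℕ) < a) ∧ ∀ j, (p.2 j : ℕ) < b}

/-- The minor of the block with given row and column indices. -/
def blockMinor (X : Matrix (Fin m) (Fin n) R) (p : BlockIndex m n a b t) : R :=
  (X.submatrix p.1.1 p.1.2).det

/-- The minor with given row and column indices bordered by the row `r` and the column `c`. -/
def borderedMinor (X : Matrix (Fin m) (Fin n) R) (r : Fin m) (c : Fin n)
    (p : BlockIndex m n a b t) : R :=
  (X.submatrix (Fin.cons r p.1.1 : Fin (t + 1) → Fin m)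
    (Fin.cons c p.1.2 : Fin (t + 1) → Fin n)).det

lemma minorIdeal_eq_span : X.minorIdeal a b t =
    Ideal.span (Set.range (X.blockMinor : BlockIndex m n a b t → R)) := by
  refine congrArg Ideal.span (Set.ext fun d => ⟨?_, ?_⟩)
  · rintro ⟨f, g, hf, hg, rfl⟩
    exact ⟨⟨(f, g), hf, hg⟩, rfl⟩
  · rintro ⟨p, rfl⟩
    exact ⟨_, _, p.2.1, p.2.2, rfl⟩

variable (X t) in
lemma minorIdeal_eq_sup (r : Fin m) (c : Fin n) : X.minorIdeal (r + 1) (c + 1) (t + 1) =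
    X.minorIdeal r (c + 1) (t + 1) ⊔ X.minorIdeal (r + 1) c (t + 1) ⊔
      Ideal.span (Set.range (X.borderedMinor r c : BlockIndex m n r c t → R)) := by
  refine le_antisymm (minorIdeal_le fun f g hf hg => ?_) (sup_le (sup_le ?_ ?_) ?_)
  · set J := X.minorIdeal r (c + 1) (t + 1) ⊔ X.minorIdeal (r + 1) c (t + 1) ⊔
      Ideal.span (Set.range (X.borderedMinor r c : BlockIndex m n r c t → R)) with hJ
    by_cases h₁ : ∀ i, (f i : ℕ) < r
    · exact le_sup_left (α := Ideal R) (le_sup_left (α := Ideal R)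
        (det_submatrix_mem_minorIdeal h₁ hg))
    by_cases h₂ : ∀ j, (g j : ℕ) < c
    · exact le_sup_left (α := Ideal R) (le_sup_right (α := Ideal R)
        (det_submatrix_mem_minorIdeal hf h₂))
    push Not at h₁ h₂
    obtain ⟨i₀, hi₀⟩ := h₁
    obtain ⟨j₀, hj₀⟩ := h₂
    have hr : f i₀ = r := Fin.ext (le_antisymm (Nat.lt_succ_iff.mp (hf i₀)) hi₀)
    have hc : g j₀ = c := Fin.ext (le_antisymm (Nat.lt_succ_iff.mp (hg j₀)) hj₀)
    by_cases h₃ : ∃ i, f (i₀.succAbove i) = r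
    · obtain ⟨i, hi⟩ := h₃
      rw [det_zero_of_row_eq (Fin.succAbove_ne i₀ i)]
      · exact zero_mem _
      · ext k
        simp [hi, hr]
    by_cases h₄ : ∃ j, g (j₀.succAbove j) = c
    · obtain ⟨j, hj⟩ := h₄
      rw [det_zero_of_column_eq (Fin.succAbove_ne j₀ j)]
      · exact zero_mem _
      · intro k
        simp [hj, hc]
    push Not at h₃ h₄
    have hfe : (Fin.cons r (i₀.removeNth f) : Fin (t + 1) → Fin m) = f ∘ i₀.cycleRange.symm := by
      rw [← hr, Fin.cons_removeNth_eq_comp_cycleRange_symm]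
    have hge : (Fin.cons c (j₀.removeNth g) : Fin (t + 1) → Fin n) = g ∘ j₀.cycleRange.symm := by
      rw [← hc, Fin.cons_removeNth_eq_comp_cycleRange_symm]
    let p : BlockIndex m n r c t := ⟨(i₀.removeNth f, j₀.removeNth g),
      fun i => lt_of_le_of_ne (Nat.lt_succ_iff.mp (hf _)) fun h => h₃ i (Fin.ext h),
      fun j => lt_of_le_of_ne (Nat.lt_succ_iff.mp (hg _)) fun h => h₄ j (Fin.ext h)⟩
    have hp : X.borderedMinor r c p ∈ J :=
      le_sup_right (α := Ideal R) (Ideal.subset_span ⟨p, rfl⟩)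
    have hdet : X.borderedMinor r c p = Equiv.Perm.sign i₀.cycleRange.symm *
        (Equiv.Perm.sign j₀.cycleRange.symm * (X.submatrix f g).det) := by
      rw [← det_permute', ← det_permute, borderedMinor]
      simp only [p, hfe, hge]
      rfl
    rw [hdet] at hp
    have hunit : ∀ (e : ℤˣ) (x : R), ((e : ℤ) : R) * x ∈ J → x ∈ J := by
      intro e x hx
      have := J.mul_mem_left ((e : ℤ) : R) hx
      rwa [← mul_assoc, ← Int.cast_mul, ← Units.val_mul, Int.units_mul_self, Units.val_one,
        Int.cast_one, one_mul] at this
    exact hunit _ _ (hunit _ _ hp)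
  · exact minorIdeal_mono X (Nat.le_succ _) le_rfl
  · exact minorIdeal_mono X le_rfl (Nat.le_succ _)
  · refine Ideal.span_le.mpr ?_
    rintro _ ⟨p, rfl⟩
    refine det_submatrix_mem_minorIdeal (fun i => ?_) fun j => ?_
    · refine Fin.cases ?_ (fun i => ?_) i
      · simp
      · simpa using (p.2.1 i).trans (Nat.lt_succ_self _)
    · refine Fin.cases ?_ (fun j => ?_) j
      · simp
      · simpa using (p.2.2 j).trans (Nat.lt_succ_self _)

/-- Bordered minors are proportional to the unbordered ones. -/
lemma borderedMinor_mul_blockMinor_sub_mem {N : Ideal R} {r : Fin m} {c : Fin n}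
    (h₁ : X.minorIdeal r (c + 1) (t + 1) ≤ N) (h₂ : X.minorIdeal (r + 1) c (t + 1) ≤ N)
    (p₁ p₂ : BlockIndex m n r c t) :
    X.borderedMinor r c p₁ * X.blockMinor p₂ - X.borderedMinor r c p₂ * X.blockMinor p₁ ∈ N := by
  have key : ∀ {s : ℕ} (f : Fin s → Fin m) (g : Fin s → Fin n),
      ((X.map (Ideal.Quotient.mk N)).submatrix f g).det = Ideal.Quotient.mk N (X.submatrix f g).det :=
    fun f g => ((Ideal.Quotient.mk N).map_det _).symm
  rw [← Ideal.Quotient.eq, map_mul, map_mul]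
  simp only [blockMinor, borderedMinor, ← key]
  refine det_submatrix_cons_mul_det_submatrix _ _ _ _ _ _ _ (fun i => ?_) fun j => ?_
  · rw [key, Ideal.Quotient.eq_zero_iff_mem]
    refine h₁ (det_submatrix_mem_minorIdeal (fun k => ?_) fun k => ?_)
    · refine Fin.cases ?_ (fun k => ?_) k
      · simpa using p₁.2.1 i
      · simpa using p₂.2.1 k
    · refine Fin.cases ?_ (fun k => ?_) k
      · simp
      · simpa using (p₂.2.2 k).trans (Nat.lt_succ_self _)
  · rw [key, Ideal.Quotient.eq_zero_iff_mem]
    refine h₂ (det_submatrix_mem_minorIdeal (fun k => ?_) fun k => ?_)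
    · refine Fin.cases ?_ (fun k => ?_) k
      · simp
      · simpa using (p₁.2.1 k).trans (Nat.lt_succ_self _)
    · refine Fin.cases ?_ (fun k => ?_) k
      · simpa using p₂.2.2 j
      · simpa using p₁.2.2 k

end Matrix

end

section

open CategoryTheory Abelian

open scoped Polynomial

lemma HasCodepthLE.of_subsingleton {R : Type u} [CommRing R] (c : ℕ) (M : ModuleCat.{u} R)
    [Subsingleton M] : HasCodepthLE c M := by
  intro Q _ i _
  have h : 𝟙 M = 0 := (ModuleCat.isZero_of_subsingleton M).eq_of_src _ _
  refine subsingleton_of_forall_eq 0 fun e => ?_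
  rw [← e.comp_mk₀_id, h, Ext.mk₀_zero, Ext.comp_zero]

namespace MvPolynomial

variable {F σ : Type*} [CommRing F] [DecidableEq σ]

/-- The embedding of a polynomial ring into a polynomial ring over itself which singles out the
variable `y`. -/
noncomputable def isolate (y : σ) : MvPolynomial σ F →+* (MvPolynomial σ F)[X] :=
  eval₂Hom (Polynomial.C.comp C) fun v => if v = y then Polynomial.X else Polynomial.C (X v)

lemma isolate_X_self (y : σ) : isolate y (X y : MvPolynomial σ F) = Polynomial.X := by
  simp [isolate]

lemma isolate_X_of_ne {y v : σ} (h : v ≠ y) :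
    isolate y (X v : MvPolynomial σ F) = Polynomial.C (X v) := by
  simp [isolate, h]

lemma eval_isolate (y : σ) (u : MvPolynomial σ F) : (isolate y u).eval (X y) = u := by
  have h : (Polynomial.evalRingHom (X y)).comp (isolate y) = RingHom.id (MvPolynomial σ F) := by
    ext v : 2
    · simp [isolate]
    · by_cases hv : v = y
      · simp [hv, isolate_X_self]
      · simp [isolate_X_of_ne hv]
  exact DFunLike.congr_fun h u

end MvPolynomial

namespace Matrix

open MvPolynomial

variable {F : Type*} [CommRing F] {m n : ℕ}

lemma isolate_det_submatrix {r : Fin m} {c : Fin n} {s : ℕ} {f : Fin s → Fin m} {g : Fin s → Fin n}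
    (h : ∀ i j, (f i, g j) ≠ (r, c)) :
    isolate (r, c) ((mvPolynomialX (Fin m) (Fin n) F).submatrix f g).det =
      Polynomial.C ((mvPolynomialX (Fin m) (Fin n) F).submatrix f g).det := by
  rw [RingHom.map_det, RingHom.map_det]
  congr 1
  ext1 i j
  exact isolate_X_of_ne (h i j)

lemma map_isolate_minorIdeal_le {r : Fin m} {c : Fin n} {a b t : ℕ}
    (h : a ≤ r ∨ b ≤ c) :
    ((mvPolynomialX (Fin m) (Fin n) F).minorIdeal a b t).map (isolate (r, c)) ≤
      ((mvPolynomialX (Fin m) (Fin n) F).minorIdeal a b t).map Polynomial.C := by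
  rw [Ideal.map_le_iff_le_comap]
  refine minorIdeal_le fun f g hf hg => ?_
  rw [Ideal.mem_comap, isolate_det_submatrix]
  · exact Ideal.mem_map_of_mem _ (det_submatrix_mem_minorIdeal hf hg)
  · intro i j hij
    rw [Prod.mk.injEq] at hij
    have h₁ := hf i
    have h₂ := hg j
    rw [hij.1] at h₁
    rw [hij.2] at h₂
    omega

lemma det_submatrix_cons_sub_congr {S α β : Type*} [CommRing S] {Y Z : Matrix α β S} {s : ℕ}
    {a : α} {b : β} {A : Fin s → α} {B : Fin s → β} (h₁ : ∀ i j, Y (A i) (B j) = Z (A i) (B j))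
    (h₂ : ∀ j, Y a (B j) = Z a (B j)) (h₃ : ∀ i, Y (A i) b = Z (A i) b) :
    (Y.submatrix (Fin.cons a A : Fin (s + 1) → α) (Fin.cons b B : Fin (s + 1) → β)).det -
        Y a b * (Y.submatrix A B).det =
      (Z.submatrix (Fin.cons a A : Fin (s + 1) → α) (Fin.cons b B : Fin (s + 1) → β)).det -
        Z a b * (Z.submatrix A B).det := by
  have h : Y.submatrix A B = Z.submatrix A B := Matrix.ext h₁
  rw [det_submatrix_cons, det_submatrix_cons, h, funext h₂, funext h₃]
  ring

lemma isolate_borderedMinor {r : Fin m} {c : Fin n} {t : ℕ} (p : BlockIndex m n r c t) :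
    isolate (r, c) ((mvPolynomialX (Fin m) (Fin n) F).borderedMinor r c p) =
      Polynomial.X * Polynomial.C ((mvPolynomialX (Fin m) (Fin n) F).blockMinor p) +
        Polynomial.C ((mvPolynomialX (Fin m) (Fin n) F).borderedMinor r c p -
          X (r, c) * (mvPolynomialX (Fin m) (Fin n) F).blockMinor p) := by
  have hr : ∀ i, p.1.1 i ≠ r := fun i h => (p.2.1 i).ne (congrArg Fin.val h)
  have hc : ∀ j, p.1.2 j ≠ c := fun j h => (p.2.2 j).ne (congrArg Fin.val h)
  have e : ∀ i j, (i ≠ r ∨ j ≠ c) →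
      (mvPolynomialX (Fin m) (Fin n) F).map (isolate (r, c)) i j =
        (mvPolynomialX (Fin m) (Fin n) F).map Polynomial.C i j := by
    intro i j hij
    refine isolate_X_of_ne fun h => ?_
    rw [Prod.mk.injEq] at h
    tauto
  have key := det_submatrix_cons_sub_congr (a := r) (b := c) (A := p.1.1) (B := p.1.2)
    (fun i j => e _ _ (Or.inl (hr i))) (fun j => e _ _ (Or.inr (hc j)))
    fun i => e _ _ (Or.inl (hr i))
  have hM : ∀ (φ : MvPolynomial (Fin m × Fin n) F →+* (MvPolynomial (Fin m × Fin n) F)[X]) {s : ℕ}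
      (f : Fin s → Fin m) (g : Fin s → Fin n),
      (((mvPolynomialX (Fin m) (Fin n) F).map φ).submatrix f g).det =
        φ ((mvPolynomialX (Fin m) (Fin n) F).submatrix f g).det :=
    fun φ _ f g => (φ.map_det _).symm
  rw [hM, hM, hM, hM, map_apply, map_apply, mvPolynomialX_apply, isolate_X_self,
    isolate_det_submatrix fun i j h => hr i (congrArg Prod.fst h)] at key
  rw [borderedMinor, blockMinor, Polynomial.C_sub, Polynomial.C_mul]
  linear_combination key

end Matrix

end

section

open CategoryTheory Abelian

namespace Matrix

section MixedIdeal

variable {R : Type*} [CommRing R] {m n : ℕ} (X : Matrix (Fin m) (Fin n) R)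

/-- The ideal generated by the `t × t` minors of the upper left `a × b` block of `X`, for all
triples `(a, b, t)` in `T`. -/
def mixedIdeal (T : Finset (ℕ × ℕ × ℕ)) : Ideal R :=
  T.sup fun τ => X.minorIdeal τ.1 τ.2.1 τ.2.2

/-- The box whose number of cells is the height of the ideal of `t × t` minors of a generic
`a × b` matrix. -/
def codimBox (τ : ℕ × ℕ × ℕ) : Finset (ℕ × ℕ) :=
  Finset.range (τ.1 + 1 - τ.2.2) ×ˢ Finset.range (τ.2.1 + 1 - τ.2.2)

/-- The expected height of `mixedIdeal X T` for generic `X`. -/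
def mixedCodim (T : Finset (ℕ × ℕ × ℕ)) : ℕ := (T.biUnion codimBox).card

/-- One of the two blocks is at most as high and at least as wide as the other one. -/
def BlockComparable (τ σ : ℕ × ℕ × ℕ) : Prop :=
  (τ.1 ≤ σ.1 ∧ σ.2.1 ≤ τ.2.1) ∨ (σ.1 ≤ τ.1 ∧ τ.2.1 ≤ σ.2.1)

lemma BlockComparable.symm {τ σ : ℕ × ℕ × ℕ} (h : BlockComparable τ σ) : BlockComparable σ τ := by
  unfold BlockComparable at *
  tauto

lemma BlockComparable.refl (τ : ℕ × ℕ × ℕ) : BlockComparable τ τ := Or.inl ⟨le_rfl, le_rfl⟩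

lemma blockComparable_insert {T : Finset (ℕ × ℕ × ℕ)} {ρ : ℕ × ℕ × ℕ}
    (hT : ∀ τ ∈ T, ∀ σ ∈ T, BlockComparable τ σ) (hρ : ∀ σ ∈ T, BlockComparable ρ σ) :
    ∀ τ ∈ insert ρ T, ∀ σ ∈ insert ρ T, BlockComparable τ σ := by
  intro τ hτ σ hσ
  rcases Finset.mem_insert.mp hτ with rfl | hτ' <;>
    rcases Finset.mem_insert.mp hσ with rfl | hσ'
  · exact .refl _
  · exact hρ _ hσ'
  · exact (hρ _ hτ').symm
  · exact hT _ hτ' _ hσ'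

lemma mixedIdeal_insert (ρ : ℕ × ℕ × ℕ) (T : Finset (ℕ × ℕ × ℕ)) :
    X.mixedIdeal (insert ρ T) = X.minorIdeal ρ.1 ρ.2.1 ρ.2.2 ⊔ X.mixedIdeal T :=
  Finset.sup_insert

lemma minorIdeal_le_mixedIdeal {T : Finset (ℕ × ℕ × ℕ)} {τ : ℕ × ℕ × ℕ} (h : τ ∈ T) :
    X.minorIdeal τ.1 τ.2.1 τ.2.2 ≤ X.mixedIdeal T :=
  Finset.le_sup (f := fun τ : ℕ × ℕ × ℕ => X.minorIdeal τ.1 τ.2.1 τ.2.2) h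

lemma mem_codimBox {τ : ℕ × ℕ × ℕ} {x : ℕ × ℕ} :
    x ∈ codimBox τ ↔ x.1 + τ.2.2 ≤ τ.1 ∧ x.2 + τ.2.2 ≤ τ.2.1 := by
  simp only [codimBox, Finset.mem_product, Finset.mem_range]
  omega

lemma mixedIdeal_erase {T : Finset (ℕ × ℕ × ℕ)} {τ : ℕ × ℕ × ℕ} (hτ : τ ∈ T)
    (h : X.minorIdeal τ.1 τ.2.1 τ.2.2 ≤ X.mixedIdeal (T.erase τ)) :
    X.mixedIdeal (T.erase τ) = X.mixedIdeal T := by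
  rw [← Finset.insert_erase hτ, mixedIdeal_insert, Finset.insert_erase hτ, sup_eq_right.mpr h]

lemma mixedCodim_erase {T : Finset (ℕ × ℕ × ℕ)} {τ : ℕ × ℕ × ℕ} (hτ : τ ∈ T)
    (h : codimBox τ ⊆ (T.erase τ).biUnion codimBox) :
    mixedCodim (T.erase τ) = mixedCodim T := by
  rw [mixedCodim, mixedCodim, ← Finset.insert_erase hτ, Finset.biUnion_insert,
    Finset.insert_erase hτ, Finset.union_eq_right.mpr h]

end MixedIdeal

lemma mixedCodim_insert_corner {a b t : ℕ} (T : Finset (ℕ × ℕ × ℕ)) :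
    mixedCodim (insert (a, b, t) T) = mixedCodim (insert (a + 1, b + 1, t + 1) T) := by
  have : codimBox (a, b, t) = codimBox (a + 1, b + 1, t + 1) := by
    ext x
    simp only [mem_codimBox]
    omega
  rw [mixedCodim, mixedCodim, Finset.biUnion_insert, Finset.biUnion_insert, this]

lemma mixedCodim_insert_insert {a b t : ℕ} {T : Finset (ℕ × ℕ × ℕ)} (ha : t ≤ a) (hb : t ≤ b)
    (hT : ∀ σ ∈ T, ¬ (a + 1 + σ.2.2 ≤ σ.1 + (t + 1) ∧ b + 1 + σ.2.2 ≤ σ.2.1 + (t + 1))) :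
    mixedCodim (insert (a + 1, b + 1, t + 1) T) =
      mixedCodim (insert (a, b + 1, t + 1) (insert (a + 1, b, t + 1) T)) + 1 := by
  have h : (insert (a + 1, b + 1, t + 1) T).biUnion codimBox =
      insert (a - t, b - t)
        ((insert (a, b + 1, t + 1) (insert (a + 1, b, t + 1) T)).biUnion codimBox) := by
    ext ⟨i, j⟩
    simp only [Finset.biUnion_insert, Finset.mem_union, Finset.mem_insert, mem_codimBox,
      Prod.mk.injEq]
    rw [← or_assoc, ← or_assoc]
    refine or_congr_left ?_
    omega
  rw [mixedCodim, h, Finset.card_insert_of_notMem, mixedCodim]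
  simp only [Finset.biUnion_insert, Finset.mem_union, Finset.mem_biUnion, mem_codimBox, not_or,
    not_exists, not_and]
  refine ⟨by omega, by omega, fun σ hσ h₁ h₂ => hT σ hσ ?_⟩
  omega

lemma mixedIdeal_map_isolate_le {F : Type*} [CommRing F] {m n : ℕ} {r : Fin m} {c : Fin n}
    {T : Finset (ℕ × ℕ × ℕ)} (hT : ∀ τ ∈ T, τ.1 ≤ r ∨ τ.2.1 ≤ c) :
    ((mvPolynomialX (Fin m) (Fin n) F).mixedIdeal T).map (MvPolynomial.isolate (r, c)) ≤
      ((mvPolynomialX (Fin m) (Fin n) F).mixedIdeal T).map Polynomial.C := by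
  refine Ideal.map_le_iff_le_comap.mpr (Finset.sup_le fun τ hτ => ?_)
  rw [← Ideal.map_le_iff_le_comap]
  exact (map_isolate_minorIdeal_le (hT τ hτ)).trans
    (Ideal.map_mono (minorIdeal_le_mixedIdeal _ hτ))

section Generic

variable {F : Type u} [Field F] {m n : ℕ}

/-- The expected height and the Cohen–Macaulay property of the ideal of mixed minors of the generic
matrix. -/
def MixedPerfect (F : Type u) [Field F] (m n : ℕ) (T : Finset (ℕ × ℕ × ℕ)) : Prop :=
  (mixedCodim T : ℕ∞) ≤ ((mvPolynomialX (Fin m) (Fin n) F).mixedIdeal T).height ∧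
    HasCodepthLE (mixedCodim T) (ModuleCat.of (MvPolynomial (Fin m × Fin n) F)
      (MvPolynomial (Fin m × Fin n) F ⧸ (mvPolynomialX (Fin m) (Fin n) F).mixedIdeal T))

lemma MixedPerfect.of_erase {T : Finset (ℕ × ℕ × ℕ)} {τ : ℕ × ℕ × ℕ} (hτ : τ ∈ T)
    (h₁ : (mvPolynomialX (Fin m) (Fin n) F).minorIdeal τ.1 τ.2.1 τ.2.2 ≤
      (mvPolynomialX (Fin m) (Fin n) F).mixedIdeal (T.erase τ))
    (h₂ : codimBox τ ⊆ (T.erase τ).biUnion codimBox)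
    (h : MixedPerfect F m n (T.erase τ)) : MixedPerfect F m n T := by
  rw [MixedPerfect, mixedIdeal_erase _ hτ h₁, mixedCodim_erase hτ h₂] at h
  exact h

lemma mixedPerfect_empty : MixedPerfect F m n ∅ := by
  have h : (mvPolynomialX (Fin m) (Fin n) F).mixedIdeal ∅ = ⊥ := Finset.sup_empty
  rw [MixedPerfect, h]
  refine ⟨by simp [mixedCodim], ?_⟩
  refine (HasLongRegularSequences.mvPolynomial F (Fin m × Fin n)).hasCodepthLE.of_iso ?_
  exact (Submodule.quotEquivOfEqBot _ rfl).symm.toModuleIso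

lemma mixedPerfect_of_zero_mem {T : Finset (ℕ × ℕ × ℕ)} {τ : ℕ × ℕ × ℕ} (hτ : τ ∈ T)
    (h : τ.2.2 = 0) : MixedPerfect F m n T := by
  have hT : (mvPolynomialX (Fin m) (Fin n) F).mixedIdeal T = ⊤ := by
    have := minorIdeal_le_mixedIdeal (mvPolynomialX (Fin m) (Fin n) F) hτ
    rwa [h, minorIdeal_zero, top_le_iff] at this
  rw [MixedPerfect, hT]
  have : Subsingleton (MvPolynomial (Fin m × Fin n) F ⧸
      (⊤ : Ideal (MvPolynomial (Fin m × Fin n) F))) := Ideal.Quotient.subsingleton_iff.mpr rfl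
  exact ⟨by simp, HasCodepthLE.of_subsingleton _ _⟩

lemma MixedPerfect.of_corner {a b t : ℕ} {T : Finset (ℕ × ℕ × ℕ)} (ham : a + 1 ≤ m)
    (hbn : b + 1 ≤ n) (ha : t ≤ a) (hb : t ≤ b)
    (hT : ∀ σ ∈ T, ¬ (a + 1 + σ.2.2 ≤ σ.1 + (t + 1) ∧ b + 1 + σ.2.2 ≤ σ.2.1 + (t + 1)))
    (hT' : ∀ σ ∈ T, σ.1 ≤ a ∨ σ.2.1 ≤ b)
    (hN : MixedPerfect F m n (insert (a, b + 1, t + 1) (insert (a + 1, b, t + 1) T)))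
    (hC : MixedPerfect F m n (insert (a, b, t) T)) :
    MixedPerfect F m n (insert (a + 1, b + 1, t + 1) T) := by
  obtain ⟨hNht, hN⟩ := hN
  obtain ⟨hCht, hC⟩ := hC
  rw [mixedCodim_insert_corner] at hCht hC
  rw [MixedPerfect]
  rw [mixedCodim_insert_insert ha hb hT] at hCht hC ⊢
  have hmap := mixedIdeal_map_isolate_le (F := F) (r := ⟨a, ham⟩) (c := ⟨b, hbn⟩)
    (T := insert (a, b + 1, t + 1) (insert (a + 1, b, t + 1) T)) (by
      intro τ hτ
      simp only [Finset.mem_insert] at hτ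
      rcases hτ with rfl | rfl | hτ
      · exact Or.inl le_rfl
      · exact Or.inr le_rfl
      · exact hT' τ hτ)
  generalize mixedCodim (insert (a, b + 1, t + 1) (insert (a + 1, b, t + 1) T)) = k at *
  set X := mvPolynomialX (Fin m) (Fin n) F with hX
  have h₁ : X.minorIdeal a (b + 1) (t + 1) ≤
      X.mixedIdeal (insert (a, b + 1, t + 1) (insert (a + 1, b, t + 1) T)) :=
    minorIdeal_le_mixedIdeal X (τ := (a, b + 1, t + 1)) (by simp)
  have h₂ : X.minorIdeal (a + 1) b (t + 1) ≤
      X.mixedIdeal (insert (a, b + 1, t + 1) (insert (a + 1, b, t + 1) T)) :=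
    minorIdeal_le_mixedIdeal X (τ := (a + 1, b, t + 1)) (by simp)
  have hCeq : X.mixedIdeal (insert (a, b, t) T) =
      X.mixedIdeal (insert (a, b + 1, t + 1) (insert (a + 1, b, t + 1) T)) ⊔
        Ideal.span (Set.range (X.blockMinor : BlockIndex m n a b t → _)) := by
    rw [← minorIdeal_eq_span]
    simp only [mixedIdeal_insert]
    have h₃ := minorIdeal_succ_le X a b t
    have h₄ := minorIdeal_succ_le_left X a b t
    refine le_antisymm (sup_le le_sup_right ?_) (sup_le (sup_le ?_ (sup_le ?_ ?_)) ?_)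
    · exact le_sup_of_le_left (le_sup_of_le_right le_sup_right)
    · exact h₃.trans le_sup_left
    · exact h₄.trans le_sup_left
    · exact le_sup_right
    · exact le_sup_left
  have hTeq : X.mixedIdeal (insert (a + 1, b + 1, t + 1) T) =
      X.mixedIdeal (insert (a, b + 1, t + 1) (insert (a + 1, b, t + 1) T)) ⊔
        Ideal.span (Set.range
          (X.borderedMinor ⟨a, ham⟩ ⟨b, hbn⟩ : BlockIndex m n a b t → _)) := by
    have := minorIdeal_eq_sup X t ⟨a, ham⟩ ⟨b, hbn⟩
    simp only at this
    simp only [mixedIdeal_insert, this]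
    ac_rfl
  rw [hTeq]
  rw [hCeq] at hCht hC
  generalize X.mixedIdeal (insert (a, b + 1, t + 1) (insert (a + 1, b, t + 1) T)) = N at *
  have hδ := Ideal.mem_of_forall_linear_mul_mem (N := N)
    (q := (X.blockMinor : BlockIndex m n a b t → _)) (MvPolynomial.isolate (⟨a, ham⟩, ⟨b, hbn⟩))
    (MvPolynomial.X (⟨a, ham⟩, ⟨b, hbn⟩)) (MvPolynomial.eval_isolate _) hmap
    (fun p => isolate_borderedMinor (r := ⟨a, ham⟩) (c := ⟨b, hbn⟩) p)
    (HasCodepthLE.mem_of_forall_mul_mem hN hCht)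
  exact ⟨Ideal.add_one_le_height_sup_span hNht hδ, HasCodepthLE.sup_span hN hC hCht
    (borderedMinor_mul_blockMinor_sub_mem (r := ⟨a, ham⟩) (c := ⟨b, hbn⟩) h₁ h₂) hδ⟩

lemma _root_.Finset.sum_insert_le_add {α : Type*} [DecidableEq α] (f : α → ℕ) (τ : α) (T : Finset α) :
    ∑ σ ∈ insert τ T, f σ ≤ f τ + ∑ σ ∈ T, f σ := by
  by_cases h : τ ∈ T
  · rw [Finset.insert_eq_of_mem h]
    exact Nat.le_add_left _ _
  · rw [Finset.sum_insert h]

theorem mixedPerfect_of_blockComparable (T : Finset (ℕ × ℕ × ℕ))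
    (hT : ∀ τ ∈ T, τ.1 ≤ m ∧ τ.2.1 ≤ n) (hcmp : ∀ τ ∈ T, ∀ σ ∈ T, BlockComparable τ σ) :
    MixedPerfect F m n T := by
  induction h : ∑ τ ∈ T, 3 ^ (τ.1 + τ.2.1) using Nat.strong_induction_on generalizing T with
  | _ k ih
  subst h
  have herase : ∀ τ ∈ T, (mvPolynomialX (Fin m) (Fin n) F).minorIdeal τ.1 τ.2.1 τ.2.2 ≤
      (mvPolynomialX (Fin m) (Fin n) F).mixedIdeal (T.erase τ) →
      codimBox τ ⊆ (T.erase τ).biUnion codimBox → MixedPerfect F m n T := by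
    intro τ hτ h₁ h₂
    refine .of_erase hτ h₁ h₂ (ih _ ?_ _ (fun σ hσ => hT σ (Finset.mem_of_mem_erase hσ))
      (fun σ hσ ρ hρ => hcmp _ (Finset.mem_of_mem_erase hσ) _ (Finset.mem_of_mem_erase hρ)) rfl)
    exact Finset.sum_erase_lt_of_pos hτ (by positivity)
  rcases T.eq_empty_or_nonempty with rfl | hne
  · exact mixedPerfect_empty
  by_cases h0 : ∃ τ ∈ T, τ.2.2 = 0
  · obtain ⟨τ, hτ, h⟩ := h0
    exact mixedPerfect_of_zero_mem hτ h
  by_cases hlt : ∃ τ ∈ T, τ.1 < τ.2.2 ∨ τ.2.1 < τ.2.2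
  · obtain ⟨τ, hτ, h⟩ := hlt
    refine herase τ hτ ((minorIdeal_eq_bot _ h).trans_le bot_le) fun x hx => ?_
    rw [mem_codimBox] at hx
    omega
  by_cases hred : ∃ ρ ∈ T, ∃ σ ∈ T, ρ ≠ σ ∧ ρ.1 + σ.2.2 ≤ σ.1 + ρ.2.2 ∧
      ρ.2.1 + σ.2.2 ≤ σ.2.1 + ρ.2.2
  · obtain ⟨ρ, hρ, σ, hσ, hne, ha, hb⟩ := hred
    have hσ' : σ ∈ T.erase ρ := Finset.mem_erase.mpr ⟨hne.symm, hσ⟩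
    refine herase ρ hρ ((minorIdeal_le_minorIdeal _ (hcmp ρ hρ σ hσ) ha hb).trans
      (minorIdeal_le_mixedIdeal _ hσ')) fun x hx => Finset.mem_biUnion.mpr ⟨σ, hσ', ?_⟩
    rw [mem_codimBox] at hx ⊢
    omega
  push Not at h0 hlt hred
  obtain ⟨⟨a, b, t⟩, hτ, hmax⟩ := Finset.exists_max_image T
    (fun τ => toLex (τ.2.1, τ.1)) hne
  have hmax' : ∀ σ ∈ T, σ.2.1 < b ∨ σ.2.1 = b ∧ σ.1 ≤ a := fun σ hσ =>
    (Prod.Lex.toLex_le_toLex ..).mp (hmax σ hσ)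
  have ht := h0 _ hτ
  have hle := hlt _ hτ
  have hmn := hT _ hτ
  simp only at ht hle hmn
  obtain ⟨t, rfl⟩ := Nat.exists_eq_succ_of_ne_zero ht
  obtain ⟨a, rfl⟩ := Nat.exists_eq_add_of_le' (show 1 ≤ a by omega)
  obtain ⟨b, rfl⟩ := Nat.exists_eq_add_of_le' (show 1 ≤ b by omega)
  have hpos : ∀ σ ∈ T.erase (a + 1, b + 1, t + 1),
      (a + 1 ≤ σ.1 ∧ σ.2.1 ≤ b) ∨ (σ.1 ≤ a ∧ σ.2.1 = b + 1) := by
    intro σ hσ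
    obtain ⟨hne, hσ⟩ := Finset.mem_erase.mp hσ
    have h₁ := hmax' σ hσ
    have h₂ := hcmp σ hσ _ hτ
    have h₃ := hred σ hσ _ hτ hne
    have h₄ := hred _ hτ σ hσ hne.symm
    simp only [BlockComparable] at h₂ h₃ h₄
    omega
  have hcmp' : ∀ τ ∈ T.erase (a + 1, b + 1, t + 1), ∀ σ ∈ T.erase (a + 1, b + 1, t + 1),
      BlockComparable τ σ := fun σ hσ ρ hρ =>
    hcmp _ (Finset.mem_of_mem_erase hσ) _ (Finset.mem_of_mem_erase hρ)
  have hT' : ∀ τ ∈ T.erase (a + 1, b + 1, t + 1), τ.1 ≤ m ∧ τ.2.1 ≤ n := fun σ hσ =>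
    hT σ (Finset.mem_of_mem_erase hσ)
  have hirr : ∀ σ ∈ T.erase (a + 1, b + 1, t + 1),
      ¬ (a + 1 + σ.2.2 ≤ σ.1 + (t + 1) ∧ b + 1 + σ.2.2 ≤ σ.2.1 + (t + 1)) := by
    intro σ hσ h
    obtain ⟨hne, hσ⟩ := Finset.mem_erase.mp hσ
    exact (hred _ hτ σ hσ hne.symm h.1).not_ge h.2
  have hmeas := Finset.add_sum_erase T (fun τ => 3 ^ (τ.1 + τ.2.1)) hτ
  rw [← hmeas] at ih
  rw [← Finset.insert_erase hτ]
  have e₁ : 3 ^ (a + 1 + (b + 1)) = 9 * 3 ^ (a + b) := by ring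
  have e₂ : 3 ^ (a + 1 + b) = 3 * 3 ^ (a + b) := by ring
  have e₃ : 3 ^ (a + (b + 1)) = 3 * 3 ^ (a + b) := by ring
  have e₄ : 0 < 3 ^ (a + b) := by positivity
  generalize T.erase (a + 1, b + 1, t + 1) = S at *
  refine .of_corner hmn.1 hmn.2 (by omega) (by omega) hirr (fun σ hσ => by
    have := hpos σ hσ
    omega) (ih _ ?_ _ ?_ ?_ rfl) (ih _ ?_ _ ?_ ?_ rfl)
  · refine ((Finset.sum_insert_le_add _ _ _).trans (Nat.add_le_add_left (Finset.sum_insert_le_add _ _ _) _)).trans_lt ?_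
    simp only
    omega
  · simp only [Finset.forall_mem_insert]
    exact ⟨by omega, by omega, hT'⟩
  · refine blockComparable_insert (blockComparable_insert hcmp' fun σ hσ => ?_) ?_
    · have := hpos σ hσ
      simp only [BlockComparable]
      omega
    · simp only [Finset.forall_mem_insert]
      refine ⟨?_, fun σ hσ => ?_⟩
      · simp only [BlockComparable]
        omega
      · have := hpos σ hσ
        simp only [BlockComparable]
        omega
  · refine (Finset.sum_insert_le_add _ _ _).trans_lt ?_
    simp only
    omega
  · simp only [Finset.forall_mem_insert]
    exact ⟨by omega, hT'⟩
  · refine blockComparable_insert hcmp' fun σ hσ => ?_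
    have := hpos σ hσ
    simp only [BlockComparable]
    omega

end Generic

end Matrix

end

section

open CategoryTheory Abelian

lemma Ideal.height_le_of_height_comap_mk_le {R : Type*} [CommRing R] {I : Ideal R} {c : ℕ}
    (hc : (c : ℕ∞) ≤ I.height) {n : ℕ} (p : Ideal (R ⧸ I)) [p.IsPrime]
    (h : (p.comap (Ideal.Quotient.mk I)).height ≤ ((n + c : ℕ) : ℕ∞)) : p.height ≤ n := by
  induction n generalizing p with
  | zero =>
    refine Ideal.height_le_iff.mpr fun q hq hqp => ?_
    have h₁ := Ideal.height_add_one_le_of_lt_of_isPrime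
      (I := q.comap (Ideal.Quotient.mk I)) (J := p.comap (Ideal.Quotient.mk I))
      ((Ideal.orderEmbeddingOfSurjective _ Ideal.Quotient.mk_surjective).strictMono hqp)
    have h₂ : I.height ≤ (q.comap (Ideal.Quotient.mk I)).height :=
      Ideal.height_mono (by simpa using Ideal.ker_le_comap (Ideal.Quotient.mk I) (K := q))
    have h₃ := (add_le_add_left (hc.trans h₂) 1).trans (h₁.trans h)
    rw [zero_add] at h₃
    norm_cast at h₃
    omega
  | succ n ih =>
    refine Ideal.height_le_iff.mpr fun q hq hqp => ?_
    have h₁ := Ideal.height_add_one_le_of_lt_of_isPrime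
      (I := q.comap (Ideal.Quotient.mk I)) (J := p.comap (Ideal.Quotient.mk I))
      ((Ideal.orderEmbeddingOfSurjective _ Ideal.Quotient.mk_surjective).strictMono hqp)
    have h₂ := h₁.trans h
    rw [show n + 1 + c = n + c + 1 by ring, Nat.cast_succ,
      ENat.add_le_add_iff_right ENat.one_ne_top] at h₂
    exact (ih q h₂).trans_lt (by norm_cast; omega)

lemma coe_idealDepth_le_ringKrullDim {A : Type*} [CommRing A] [IsLocalRing A] [IsNoetherianRing A]
    (M : Ideal A) : (idealDepth M : WithBot ℕ∞) ≤ ringKrullDim A := by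
  rw [← IsLocalRing.maximalIdeal_height_eq_ringKrullDim, WithBot.coe_le_coe]
  refine iSup₂_le fun rs hrs => ?_
  rw [← WithBot.coe_le_coe, IsLocalRing.maximalIdeal_height_eq_ringKrullDim,
    ← ringKrullDim_add_length_eq_ringKrullDim_of_isRegular rs hrs.2]
  have : Nontrivial (A ⧸ Ideal.ofList rs) := by
    refine Ideal.Quotient.nontrivial_iff.mpr fun h => hrs.2.top_ne_smul ?_
    simp [h]
  exact le_add_of_nonneg_left ringKrullDim_nonneg_of_nontrivial

lemma HasCodepthLE.isCMLocalRing_localization {R : Type u} [CommRing R] [IsNoetherianRing R]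
    {I : Ideal R} {c : ℕ} (hc : (c : ℕ∞) ≤ I.height)
    (hI : HasCodepthLE c (ModuleCat.of R (R ⧸ I))) (p : Ideal (R ⧸ I)) [p.IsPrime] :
    IsCMLocalRing (Localization.AtPrime p) := by
  refine ⟨inferInstance, fun M hM => (coe_idealDepth_le_ringKrullDim M).antisymm ?_⟩
  rw [IsLocalRing.eq_maximalIdeal hM,
    IsLocalization.AtPrime.ringKrullDim_eq_height p (Localization.AtPrime p), WithBot.coe_le_coe]
  have hIP : I ≤ p.comap (Ideal.Quotient.mk I) := by
    simpa using Ideal.ker_le_comap (Ideal.Quotient.mk I) (K := p)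
  obtain ⟨h, hh⟩ := ENat.ne_top_iff_exists.mp
    ((p.comap (Ideal.Quotient.mk I)).height_ne_top (Ideal.IsPrime.ne_top inferInstance))
  have hch : c ≤ h := by
    have := hc.trans (Ideal.height_mono hIP)
    rw [← hh] at this
    exact_mod_cast this
  obtain ⟨n, rfl⟩ := Nat.exists_eq_add_of_le' hch
  obtain ⟨rs, hlen, hmem, hreg⟩ := hI.exists_isRegular _ hIP hh.le
  refine (Ideal.height_le_of_height_comap_mk_le hc p hh.ge).trans ?_
  have hreg' := ((RingTheory.Sequence.isWeaklyRegular_map_algebraMap_iff (R ⧸ I) (R ⧸ I) rs).mpr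
    hreg.toIsWeaklyRegular).isRegular_of_isLocalization_of_mem (Localization.AtPrime p) p (by
      intro r hr
      obtain ⟨s, hs, rfl⟩ := List.mem_map.mp hr
      exact hmem s hs)
  refine le_iSup₂_of_le _ ⟨?_, hreg'⟩ ?_
  · intro x hx
    obtain ⟨y, hy, rfl⟩ := List.mem_map.mp hx
    obtain ⟨s, hs, rfl⟩ := List.mem_map.mp hy
    exact (IsLocalization.AtPrime.to_map_mem_maximal_iff (Localization.AtPrime p) p _).mpr
      (hmem s hs)
  · simp [hlen]

lemma detIdeal_eq_minorIdeal {R : Type*} [CommRing R] {m n : ℕ} (A : Matrix (Fin m) (Fin n) R)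
    (t : ℕ) : detIdeal A (t : ℤ) = A.minorIdeal m n t := by
  refine le_antisymm (Ideal.span_le.mpr ?_) (Matrix.minorIdeal_le fun f g _ _ => ?_)
  · rintro _ ⟨f, g, -, -, rfl⟩
    exact Matrix.det_submatrix_mem_minorIdeal (fun i => (f i).2) fun j => (g j).2
  by_cases hf : Function.Injective f
  · by_cases hg : Function.Injective g
    · exact Ideal.subset_span ⟨f, g, hf, hg, rfl⟩
    · simp only [Function.Injective, not_forall] at hg
      obtain ⟨i, j, hij, hne⟩ := hg
      rw [Matrix.det_zero_of_column_eq hne fun k => by simp [hij]]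
      exact zero_mem _
  · simp only [Function.Injective, not_forall] at hf
    obtain ⟨i, j, hij, hne⟩ := hf
    rw [Matrix.det_zero_of_row_eq hne (by ext; simp [hij])]
    exact zero_mem _

end

/-- Over the polynomial ring `R = F[x_{ij}]` in `m * n` variables over a field `F`, with
`X` the generic `m × n` matrix whose `(i, j)` entry is the variable `x_{ij}`, and
`1 ≤ t ≤ min m n`, the quotient `R / I_t(X)` is Cohen–Macaulay: its localization at every
prime ideal is a Cohen–Macaulay local ring. -/
theorem quotient_detIdeal_genericMatrix_isCM
    (F : Type*) [Field F] {m n : ℕ} (hm : 1 ≤ m) (hn : 1 ≤ n)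
    (t : ℕ) (ht1 : 1 ≤ t) (ht2 : t ≤ min m n) :
    letI R := MvPolynomial (Fin m × Fin n) F
    letI X : Matrix (Fin m) (Fin n) R := Matrix.of fun i j => MvPolynomial.X (i, j)
    ∀ (p : Ideal (R ⧸ detIdeal X (t : ℤ))) (hp : p.IsPrime),
      IsCMLocalRing (Localization.AtPrime p) := by
  intro p hp
  obtain ⟨hht, hcd⟩ := Matrix.mixedPerfect_of_blockComparable (F := F) (m := m) (n := n)
    {(m, n, t)} (by simp) (by simp [Matrix.BlockComparable.refl])
  have hX : (Matrix.mvPolynomialX (Fin m) (Fin n) F).mixedIdeal {(m, n, t)} =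
      detIdeal (Matrix.of fun i j => MvPolynomial.X (i, j)) (t : ℤ) := by
    rw [detIdeal_eq_minorIdeal]
    exact Finset.sup_singleton
  rw [hX] at hht hcd
  exact hcd.isCMLocalRing_localization hht p
end
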